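/- Let f be a tempered distribution on gl₂(𝕂) × gl₂(𝕂) (viewed as a finite-dimensional real vector space). Suppose that: (i) for every g ∈ GL₂(𝕂) and every Schwartz function φ on gl₂(𝕂) × gl₂(𝕂), f((x,y) ↦ φ(g·x·g⁻¹, g·y·g⁻¹)) = f(φ); and (ii) for every Schwartz function φ, f((x,y) ↦ φ(x^τ, y^τ)) = −f(φ). Then f = 0. -/

import Mathlib

open Matrix

attribute [local instance] Matrix.normedAddCommGroup Matrix.normedSpace

section Auxiliary

open scoped ContDiff Topology
open Filter

section Calculus

variable {D : Type} [NormedAddCommGroup D] [NormedSpace ℝ D]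

/-- The first order Taylor expansion of the translates of a compactly supported smooth function
is uniform, together with all derivatives. -/
lemma exists_iteratedFDeriv_translate_sub_le (l : ℕ) :
    ∀ {F : Type} [NormedAddCommGroup F] [NormedSpace ℝ F] (u : D → F)
    (_ : ContDiff ℝ ∞ u) (_ : HasCompactSupport u) (v : D),
    ∃ C : ℝ, ∀ t : ℝ, ∀ z : D,
      ‖iteratedFDeriv ℝ l (fun z => u (z + t • v) - u z - t • fderiv ℝ u z v) z‖ ≤ C * t ^ 2 := by
  induction l with
  | zero =>
    intro F _ _ u hu hc v
    have hd : ContDiff ℝ 1 (fderiv ℝ u) := hu.fderiv_right (by norm_cast)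
    obtain ⟨K, hK⟩ := ContDiff.lipschitzWith_of_hasCompactSupport (hc.fderiv (𝕜 := ℝ)) hd one_ne_zero
    refine ⟨K * ‖v‖ ^ 2, fun t z => ?_⟩
    rw [norm_iteratedFDeriv_zero]
    have key := (convex_closedBall z (|t| * ‖v‖)).norm_image_sub_le_of_norm_hasFDerivWithin_le'
      (f := u) (f' := fderiv ℝ u) (φ := fderiv ℝ u z) (C := K * (|t| * ‖v‖)) (x := z)
      (y := z + t • v)
      (fun x _ => ((hu.differentiable (by simp)) x).hasFDerivAt.hasFDerivWithinAt)
      (fun x hx => by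
        have := hK.dist_le_mul x z
        rw [dist_eq_norm] at this
        exact this.trans (by gcongr; exact hx))
      (by simp; positivity) (by simp [norm_smul])
    simp only [add_sub_cancel_left, map_smul, norm_smul, Real.norm_eq_abs] at key
    refine key.trans (le_of_eq ?_)
    rw [← sq_abs t]; ring
  | succ l ih =>
    intro F _ _ u hu hc v
    have hd : ContDiff ℝ ∞ (fderiv ℝ u) := hu.fderiv_right (by norm_cast)
    obtain ⟨C, hC⟩ := ih (fderiv ℝ u) hd (hc.fderiv (𝕜 := ℝ)) v
    refine ⟨C, fun t z => ?_⟩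
    rw [← norm_iteratedFDeriv_fderiv]
    convert hC t z using 3
    ext1 w
    have hdiff : ∀ x, DifferentiableAt ℝ u x := hu.differentiable (by simp)
    have hdd : ∀ x, DifferentiableAt ℝ (fderiv ℝ u) x := hd.differentiable (by simp)
    have h1 : HasFDerivAt (fun z => u (z + t • v)) (fderiv ℝ u (w + t • v)) w := by
      simpa [Function.comp_def] using
        (hdiff (w + t • v)).hasFDerivAt.comp w ((hasFDerivAt_id w).add_const (t • v))
    have h2 : HasFDerivAt (fun z => fderiv ℝ u z v)
        ((ContinuousLinearMap.apply ℝ F v).comp (fderiv ℝ (fderiv ℝ u) w)) w :=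
      (ContinuousLinearMap.apply ℝ F v).hasFDerivAt.comp w (hdd w).hasFDerivAt
    have h3 := (h1.sub (hdiff w).hasFDerivAt).sub (h2.const_smul t)
    refine h3.fderiv.trans ?_
    congr 2
    ext y
    have hs := (hu.contDiffAt (x := w)).isSymmSndFDerivAt
      (by simpa using WithTop.coe_le_coe.2 (le_top (a := (2 : ℕ∞))))
    exact hs y v

variable {E : Type} [NormedAddCommGroup E] [NormedSpace ℝ E]

/-- A test function: smooth with compact support. -/
def IsTest (u : E → ℂ) : Prop := ContDiff ℝ ∞ u ∧ HasCompactSupport u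

open Classical in
/-- A tempered distribution evaluated on test functions, extended by zero. -/
noncomputable def evalTest (f : SchwartzMap E ℂ →L[ℂ] ℂ) (u : E → ℂ) : ℂ :=
  if h : IsTest u then f (h.2.toSchwartzMap h.1) else 0

lemma evalTest_eq (f : SchwartzMap E ℂ →L[ℂ] ℂ) (φ : SchwartzMap E ℂ) {u : E → ℂ}
    (h : IsTest u) (hφ : ∀ x, φ x = u x) : evalTest f u = f φ := by
  rw [evalTest, dif_pos h]
  congr 1
  ext x
  simp [hφ]

lemma IsTest.add {u v : E → ℂ} (hu : IsTest u) (hv : IsTest v) :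
    IsTest (fun x => u x + v x) := ⟨hu.1.add hv.1, hu.2.add hv.2⟩

lemma IsTest.const_mul {u : E → ℂ} (c : ℂ) (hu : IsTest u) :
    IsTest (fun x => c * u x) := ⟨contDiff_const.mul hu.1, hu.2.mul_left⟩

lemma IsTest.sub {u v : E → ℂ} (hu : IsTest u) (hv : IsTest v) :
    IsTest (fun x => u x - v x) := by
  simpa [sub_eq_add_neg] using hu.add (hv.const_mul (-1))

lemma IsTest.mul {u v : E → ℂ} (hv : ContDiff ℝ ∞ v) (hu : IsTest u) :
    IsTest (fun x => v x * u x) := ⟨hv.mul hu.1, hu.2.mul_left⟩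

lemma IsTest.zero : IsTest (fun _ : E => (0 : ℂ)) := by
  refine ⟨contDiff_const, ?_⟩
  exact HasCompactSupport.zero

lemma IsTest.sum {ι : Type*} (s : Finset ι) {u : ι → E → ℂ} (hu : ∀ i ∈ s, IsTest (u i)) :
    IsTest (fun x => ∑ i ∈ s, u i x) := by
  classical
  induction s using Finset.induction_on with
  | empty => simpa using IsTest.zero
  | insert a s ha ih =>
    simp only [Finset.sum_insert ha]
    exact (hu a (by simp)).add (ih fun i hi => hu i (by simp [hi]))

lemma evalTest_add (f : SchwartzMap E ℂ →L[ℂ] ℂ) {u v : E → ℂ} (hu : IsTest u) (hv : IsTest v) :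
    evalTest f (fun x => u x + v x) = evalTest f u + evalTest f v := by
  rw [evalTest_eq f (hu.2.toSchwartzMap hu.1) hu (fun _ => rfl),
    evalTest_eq f (hv.2.toSchwartzMap hv.1) hv (fun _ => rfl), ← map_add]
  exact evalTest_eq f _ (hu.add hv) (fun _ => rfl)

lemma evalTest_const_mul (f : SchwartzMap E ℂ →L[ℂ] ℂ) (c : ℂ) {u : E → ℂ} (hu : IsTest u) :
    evalTest f (fun x => c * u x) = c * evalTest f u := by
  rw [evalTest_eq f (hu.2.toSchwartzMap hu.1) hu (fun _ => rfl), ← smul_eq_mul, ← map_smul]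
  exact evalTest_eq f _ (hu.const_mul c) (fun _ => rfl)

lemma evalTest_sub (f : SchwartzMap E ℂ →L[ℂ] ℂ) {u v : E → ℂ} (hu : IsTest u) (hv : IsTest v) :
    evalTest f (fun x => u x - v x) = evalTest f u - evalTest f v := by
  have h := evalTest_add f hu (hv.const_mul (-1))
  rw [evalTest_const_mul f _ hv] at h
  simpa [sub_eq_add_neg] using h

lemma evalTest_zero (f : SchwartzMap E ℂ →L[ℂ] ℂ) : evalTest f (fun _ => 0) = 0 := by
  simpa using evalTest_const_mul f 0 (IsTest.zero (E := E))

lemma evalTest_sum (f : SchwartzMap E ℂ →L[ℂ] ℂ) {ι : Type*} (s : Finset ι) {u : ι → E → ℂ}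
    (hu : ∀ i ∈ s, IsTest (u i)) :
    evalTest f (fun x => ∑ i ∈ s, u i x) = ∑ i ∈ s, evalTest f (u i) := by
  classical
  induction s using Finset.induction_on with
  | empty => simpa using evalTest_zero f
  | insert a s ha ih =>
    simp only [Finset.sum_insert ha]
    rw [evalTest_add f (hu a (by simp)) (IsTest.sum s fun i hi => hu i (by simp [hi])),
      ih fun i hi => hu i (by simp [hi])]

/-- Sequential continuity of a distribution along test functions whose differences with the limit
are supported in a fixed ball. -/
lemma tendsto_evalTest (f : SchwartzMap E ℂ →L[ℂ] ℂ) {ι : Type*} {𝓁 : Filter ι}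
    {u : ι → E → ℂ} {v : E → ℂ} (hu : ∀ i, IsTest (u i)) (hv : IsTest v) {R : ℝ} (hR : 0 ≤ R)
    (hsupp : ∀ᶠ i in 𝓁, ∀ x, R < ‖x‖ → u i x = v x)
    (hlim : ∀ n : ℕ, ∀ ε > 0, ∀ᶠ i in 𝓁, ∀ x,
      ‖iteratedFDeriv ℝ n (fun x => u i x - v x) x‖ ≤ ε) :
    Tendsto (fun i => evalTest f (u i)) 𝓁 (𝓝 (evalTest f v)) := by
  have hu' : (fun i => evalTest f (u i)) = fun i => f ((hu i).2.toSchwartzMap (hu i).1) :=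
    funext fun i => evalTest_eq f _ (hu i) (fun _ => rfl)
  rw [hu', evalTest_eq f (hv.2.toSchwartzMap hv.1) hv (fun _ => rfl)]
  refine (f.continuous.tendsto _).comp ?_
  rw [(schwartz_withSeminorms ℝ E ℂ).tendsto_nhds]
  rintro ⟨k, n⟩ ε hε
  filter_upwards [hsupp, hlim n (ε / 2 / (R + 1) ^ k) (by positivity)] with i h1 h2
  rw [SchwartzMap.schwartzSeminormFamily_apply]
  refine lt_of_le_of_lt (SchwartzMap.seminorm_le_bound ℝ k n _ (half_pos hε).le fun x => ?_)
    (half_lt_self hε)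
  have hcoe : (⇑((hu i).2.toSchwartzMap (hu i).1 - hv.2.toSchwartzMap hv.1) : E → ℂ)
      = fun x => u i x - v x := rfl
  rw [hcoe]
  rcases lt_or_ge R ‖x‖ with hx | hx
  · have : (fun x => u i x - v x) =ᶠ[𝓝 x] fun _ => 0 := by
      filter_upwards [(isOpen_lt continuous_const continuous_norm).mem_nhds hx] with y hy
      rw [h1 y hy, sub_self]
    rw [(this.iteratedFDeriv ℝ n).eq_of_nhds]
    simp
    positivity
  · calc ‖x‖ ^ k * ‖iteratedFDeriv ℝ n (fun x => u i x - v x) x‖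
        ≤ (R + 1) ^ k * (ε / 2 / (R + 1) ^ k) := by
          gcongr
          · linarith
          · exact h2 x
      _ = ε / 2 := by field_simp

/-- Differentiation of a distribution along a smooth compactly supported family. -/
lemma tendsto_evalTest_slope (f : SchwartzMap E ℂ →L[ℂ] ℂ) {Ψ : ℝ × E → ℂ}
    (hΨ : ContDiff ℝ ∞ Ψ) (hc : HasCompactSupport Ψ) :
    Tendsto (fun t : ℝ => evalTest f (fun p => (t⁻¹ : ℂ) * (Ψ (t, p) - Ψ (0, p))))
      (𝓝[≠] 0) (𝓝 (evalTest f (fun p => fderiv ℝ Ψ (0, p) (1, 0)))) := by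
  have slice : ∀ {G : ℝ × E → ℂ}, ContDiff ℝ ∞ G → HasCompactSupport G → ∀ t : ℝ,
      IsTest (fun p => G (t, p)) := by
    intro G hG hGc t
    refine ⟨hG.comp (contDiff_const.prodMk contDiff_id), ?_⟩
    exact hGc.comp_isClosedEmbedding
      ⟨⟨Topology.IsInducing.of_comp (f := fun p : E => (t, p)) (g := Prod.snd) (by fun_prop)
        (by fun_prop) Topology.IsInducing.id, fun a b h => (Prod.mk.inj h).2⟩, by
        have : Set.range (fun p : E => (t, p)) = Prod.fst ⁻¹' {t} := by
          ext ⟨a, b⟩; simp [eq_comm]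
        rw [this]
        exact isClosed_singleton.preimage continuous_fst⟩
  have hderiv : ContDiff ℝ ∞ (fun z => fderiv ℝ Ψ z (1, 0)) :=
    (hΨ.fderiv_right (by norm_cast)).clm_apply contDiff_const
  have hderivc : HasCompactSupport (fun z => fderiv ℝ Ψ z (1, 0)) :=
    hc.fderiv_apply (𝕜 := ℝ) _
  obtain ⟨R, hR0, hR⟩ : ∃ R : ℝ, 0 ≤ R ∧ ∀ z : ℝ × E, R < ‖z‖ → Ψ z = 0 := by
    obtain ⟨R, hR⟩ := hc.isCompact.isBounded.exists_norm_le
    refine ⟨max R 0, le_max_right _ _, fun z hz => ?_⟩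
    by_contra h
    exact absurd (hR z (subset_tsupport _ h)) (not_le.2 ((le_max_left _ _).trans_lt hz))
  have hsn : ∀ (t : ℝ) (p : E), ‖p‖ ≤ ‖(t, p)‖ := fun t p => le_max_right _ _
  refine tendsto_evalTest f (fun t => ((slice hΨ hc t).sub (slice hΨ hc 0)).const_mul _)
    (slice hderiv hderivc 0) hR0 ?_ ?_
  · refine Eventually.of_forall fun t p hp => ?_
    have h0 : fderiv ℝ Ψ (0, p) = 0 := by
      have : Ψ =ᶠ[𝓝 (0, p)] fun _ => 0 := by
        filter_upwards [(isOpen_lt continuous_const continuous_norm).mem_nhds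
          (show R < ‖((0 : ℝ), p)‖ from hp.trans_le (hsn _ _))] with y hy using hR y hy
      rw [this.fderiv_eq]; simp
    simp [hR (t, p) (hp.trans_le (hsn _ _)), hR (0, p) (hp.trans_le (hsn _ _)), h0]
  · intro n ε hε
    obtain ⟨C, hC⟩ := exists_iteratedFDeriv_translate_sub_le n Ψ hΨ hc ((1 : ℝ), (0 : E))
    set A : ℝ := ‖ContinuousLinearMap.inr ℝ ℝ E‖ ^ n with hA
    have hA0 : 0 ≤ A := by positivity
    have hlim : Tendsto (fun t : ℝ => |t| * (|C| * A)) (𝓝[≠] 0) (𝓝 0) := by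
      have : Tendsto (fun t : ℝ => |t| * (|C| * A)) (𝓝 0) (𝓝 (|(0 : ℝ)| * (|C| * A))) := by
        apply Continuous.tendsto; fun_prop
      simp only [abs_zero, zero_mul] at this
      exact this.mono_left nhdsWithin_le_nhds
    filter_upwards [hlim.eventually (gt_mem_nhds hε), self_mem_nhdsWithin] with t ht ht0 p
    have ht0 : t ≠ 0 := ht0
    set W : ℝ × E → ℂ := fun z => Ψ (z + t • ((1 : ℝ), (0 : E))) - Ψ z
      - t • fderiv ℝ Ψ z ((1 : ℝ), (0 : E)) with hW
    have hWs : ContDiff ℝ ∞ W := by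
      refine ((hΨ.comp (contDiff_id.add contDiff_const)).sub hΨ).sub (hderiv.const_smul t)
    have heq : (fun x => (t⁻¹ : ℂ) * (Ψ (t, x) - Ψ (0, x)) - fderiv ℝ Ψ (0, x) (1, 0))
        = t⁻¹ • (W ∘ ContinuousLinearMap.inr ℝ ℝ E) := by
      ext x
      have : (t : ℂ) ≠ 0 := by exact_mod_cast ht0
      simp [hW, smul_sub]
      field_simp
    rw [heq, iteratedFDeriv_const_smul_apply, norm_smul,
      ContinuousLinearMap.iteratedFDeriv_comp_right _ hWs _ (i := n) (by exact_mod_cast le_top)]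
    · refine le_trans ?_ ht.le
      have h1 := (iteratedFDeriv ℝ n W (ContinuousLinearMap.inr ℝ ℝ E p)).norm_compContinuousLinearMap_le
        (fun _ => ContinuousLinearMap.inr ℝ ℝ E)
      simp only [Finset.prod_const, Finset.card_univ, Fintype.card_fin] at h1
      calc _ ≤ ‖t⁻¹‖ * ((C * t ^ 2) * A) := by
            gcongr
            refine h1.trans ?_
            gcongr
            exact hC t _
        _ ≤ ‖t⁻¹‖ * ((|C| * t ^ 2) * A) := by
            gcongr
            exact le_abs_self C
        _ = |t| * (|C| * A) := by
            rw [norm_inv, Real.norm_eq_abs, ← sq_abs t]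
            have : |t| ≠ 0 := abs_ne_zero.2 ht0
            field_simp
    · exact ((hWs.comp (ContinuousLinearMap.inr ℝ ℝ E).contDiff).of_le
        (by exact_mod_cast le_top)).contDiffAt

end Calculus

section Flow

variable {E : Type} [NormedAddCommGroup E] [NormedSpace ℝ E]

/-- A distribution invariant under a smooth flow is annihilated by its generator. -/
lemma evalTest_fderiv_flow_eq_zero (f : SchwartzMap E ℂ →L[ℂ] ℂ) (A : ℝ → E → E) (X : E → E)
    (hA : ContDiff ℝ ∞ (fun z : ℝ × E => A z.1 z.2)) (h0 : ∀ p, A 0 p = p)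
    (hinv : ∀ t p, A (-t) (A t p) = p) (hX : ∀ p, HasDerivAt (fun t => A t p) (X p) 0)
    (hf : ∀ t u, IsTest u → IsTest (fun p => u (A t p)) → evalTest f (fun p => u (A t p)) = evalTest f u)
    {φ : E → ℂ} (hφ : IsTest φ) :
    evalTest f (fun p => fderiv ℝ φ p (X p)) = 0 := by
  let η : ContDiffBump (0 : ℝ) := ⟨1, 2, one_pos, one_lt_two⟩
  set Ψ : ℝ × E → ℂ := fun z => (η z.1 : ℂ) * φ (A z.1 z.2) with hΨ
  have hsm : ContDiff ℝ ∞ Ψ := by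
    refine ContDiff.mul ?_ (hφ.1.comp hA)
    exact Complex.ofRealCLM.contDiff.comp (η.contDiff.comp contDiff_fst)
  have hAc : ∀ t, Continuous (fun p => A t p) := fun t =>
    hA.continuous.comp (by fun_prop : Continuous fun p : E => (t, p))
  have hc : HasCompactSupport Ψ := by
    have hK : IsCompact ((fun z : ℝ × E => (z.1, A (-z.1) z.2)) ''
        (Metric.closedBall (0 : ℝ) 2 ×ˢ tsupport φ)) := by
      refine ((isCompact_closedBall _ _).prod hφ.2.isCompact).image ?_
      refine continuous_fst.prodMk ?_
      exact hA.continuous.comp (by fun_prop : Continuous fun z : ℝ × E => (-z.1, z.2))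
    refine HasCompactSupport.intro hK fun z hz => ?_
    by_contra hne
    apply hz
    have h1 : η z.1 ≠ 0 := fun h => hne (by simp [hΨ, h])
    have h2 : φ (A z.1 z.2) ≠ 0 := fun h => hne (by simp [hΨ, h])
    refine ⟨(z.1, A z.1 z.2), ⟨?_, subset_tsupport _ h2⟩, by simp [hinv]⟩
    have : z.1 ∈ Function.support η := h1
    rw [η.support_eq] at this
    exact Metric.ball_subset_closedBall this
  have hη1 : ∀ᶠ t : ℝ in 𝓝 0, η t = 1 := η.eventuallyEq_one
  have hlim := tendsto_evalTest_slope f hsm hc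
  have hd : (fun p => fderiv ℝ Ψ (0, p) (1, 0)) = fun p => fderiv ℝ φ p (X p) := by
    ext p
    have e1 : HasDerivAt (fun t : ℝ => Ψ (t, p)) (fderiv ℝ Ψ (0, p) (1, 0)) 0 := by
      have := ((hsm.differentiable (by simp)) (0, p)).hasFDerivAt.comp_hasDerivAt (0 : ℝ)
        ((hasDerivAt_id (0 : ℝ)).prodMk (hasDerivAt_const (0 : ℝ) p))
      simpa [Function.comp_def] using this
    have e2 : HasDerivAt (fun t : ℝ => Ψ (t, p)) (fderiv ℝ φ p (X p)) 0 := by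
      have h3 : HasFDerivAt φ (fderiv ℝ φ p) (A 0 p) := by
        rw [h0]; exact ((hφ.1.differentiable (by simp)) p).hasFDerivAt
      refine (h3.comp_hasDerivAt (0 : ℝ) (hX p)).congr_of_eventuallyEq ?_
      filter_upwards [hη1] with t ht
      simp [hΨ, ht]
    exact e1.unique e2
  rw [hd] at hlim
  refine tendsto_nhds_unique hlim ?_
  refine tendsto_const_nhds.congr' ?_
  filter_upwards [hη1.filter_mono nhdsWithin_le_nhds] with t ht
  have ht' : IsTest (fun p => φ (A t p)) := by
    refine ⟨hφ.1.comp (hA.comp (contDiff_const.prodMk contDiff_id)), ?_⟩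
    refine HasCompactSupport.intro (hφ.2.isCompact.image (hAc (-t))) fun p hp => ?_
    by_contra hne
    exact hp ⟨A t p, subset_tsupport _ hne, hinv t p⟩
  have : (fun p => (t⁻¹ : ℂ) * (Ψ (t, p) - Ψ (0, p))) = fun p => (t⁻¹ : ℂ) * (φ (A t p) - φ p) := by
    ext p
    have := hη1.self_of_nhds
    simp [hΨ, ht, this, h0]
  rw [this, evalTest_const_mul f _ (ht'.sub hφ), evalTest_sub f ht' hφ, hf t φ hφ ht', sub_self,
    mul_zero]

end Flow

section Approx

variable {E : Type} [NormedAddCommGroup E] [NormedSpace ℝ E] [FiniteDimensional ℝ E]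

/-- A tempered distribution vanishing on test functions is zero. -/
lemma eq_zero_of_evalTest_eq_zero (f : SchwartzMap E ℂ →L[ℂ] ℂ)
    (h : ∀ u, IsTest u → evalTest f u = 0) : f = 0 := by
  ext φ
  let χ : ContDiffBump (0 : E) := ⟨1, 2, one_pos, one_lt_two⟩
  have hχ : ContDiff ℝ ∞ (fun x => (χ x : ℂ)) := Complex.ofRealCLM.contDiff.comp χ.contDiff
  have hχc : HasCompactSupport (fun x => (χ x : ℂ)) :=
    χ.hasCompactSupport.comp_left (g := ((↑) : ℝ → ℂ)) (by simp)
  have hscale : ∀ n : ℕ, IsTest (fun x => φ x * (χ ((n + 1 : ℝ)⁻¹ • x) : ℂ)) := by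
    intro n
    refine IsTest.mul (φ.smooth _) ⟨hχ.comp (contDiff_const_smul _), ?_⟩
    exact hχc.comp_smul (by positivity)
  have hzero : ∀ n : ℕ, f ((hscale n).2.toSchwartzMap (hscale n).1) = 0 := by
    intro n
    rw [← evalTest_eq f _ (hscale n) (fun _ => rfl)]
    exact h _ (hscale n)
  refine tendsto_nhds_unique (f := fun n : ℕ => f ((hscale n).2.toSchwartzMap (hscale n).1))
    (l := atTop) ((f.continuous.tendsto _).comp ?_) (by simp [hzero])
  rw [(schwartz_withSeminorms ℝ E ℂ).tendsto_nhds]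
  rintro ⟨k, n⟩ ε hε
  set w : E → ℂ := fun x => (χ x : ℂ) - 1 with hw
  have hws : ContDiff ℝ ∞ w := hχ.sub contDiff_const
  have hbound : ∀ i : ℕ, ∃ C : ℝ, 0 ≤ C ∧ ∀ x, ‖iteratedFDeriv ℝ i w x‖ ≤ C * ‖x‖ := by
    intro i
    have hb : ∃ C, ∀ x, ‖iteratedFDeriv ℝ i w x‖ ≤ C := by
      rcases i with _ | i
      · refine ⟨2, fun x => ?_⟩
        rw [norm_iteratedFDeriv_zero]
        refine (norm_sub_le _ _).trans ?_
        have h1 : ‖(χ x : ℂ)‖ ≤ 1 := by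
          rw [Complex.norm_real, Real.norm_eq_abs, abs_of_nonneg χ.nonneg]; exact χ.le_one
        simp only [norm_one]; linarith
      · have : iteratedFDeriv ℝ (i + 1) w = iteratedFDeriv ℝ (i + 1) (fun x => (χ x : ℂ)) := by
          have h2 := iteratedFDeriv_sub (𝕜 := ℝ) (i := i + 1) (f := fun x => (χ x : ℂ))
            (g := fun _ : E => (1 : ℂ)) (hχ.of_le (by exact_mod_cast le_top)) contDiff_const
          rw [iteratedFDeriv_const_of_ne (by omega), sub_zero] at h2
          exact h2
        rw [this]
        exact (hχ.continuous_iteratedFDeriv (by exact_mod_cast le_top)).bounded_above_of_compact_support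
          (hχc.iteratedFDeriv _)
    obtain ⟨C, hC⟩ := hb
    have hC0 : 0 ≤ C := (norm_nonneg _).trans (hC 0)
    refine ⟨C, hC0, fun x => ?_⟩
    rcases lt_or_ge ‖x‖ 1 with hx | hx
    · have : w =ᶠ[𝓝 x] fun _ => 0 := by
        filter_upwards [Metric.isOpen_ball.mem_nhds (mem_ball_zero_iff.2 hx)] with y hy
        have : χ y = 1 := χ.one_of_mem_closedBall (Metric.ball_subset_closedBall hy)
        simp [hw, this]
      rw [(this.iteratedFDeriv ℝ i).eq_of_nhds]
      simp
      positivity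
    · exact (hC x).trans (le_mul_of_one_le_right hC0 hx)
  choose C hC0 hC using hbound
  set S : ℝ := ∑ i ∈ Finset.range (n + 1), (n.choose i : ℝ) * C i *
    SchwartzMap.seminorm ℝ (k + 1) (n - i) φ with hS
  have hlim : Tendsto (fun m : ℕ => (m + 1 : ℝ)⁻¹ * S) atTop (𝓝 0) := by
    simpa [one_div] using (tendsto_one_div_add_atTop_nhds_zero_nat (𝕜 := ℝ)).mul_const S
  filter_upwards [hlim.eventually (gt_mem_nhds (half_pos hε))] with m hm
  rw [SchwartzMap.schwartzSeminormFamily_apply]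
  refine lt_of_le_of_lt (SchwartzMap.seminorm_le_bound ℝ k n _ (half_pos hε).le fun x => ?_)
    (half_lt_self hε)
  refine le_trans ?_ hm.le
  set L : E →L[ℝ] E := (m + 1 : ℝ)⁻¹ • ContinuousLinearMap.id ℝ E with hL
  have hLn : ‖L‖ ≤ (m + 1 : ℝ)⁻¹ := by
    rw [hL, norm_smul, Real.norm_of_nonneg (by positivity)]
    exact mul_le_of_le_one_right (by positivity) ContinuousLinearMap.norm_id_le
  have hL1 : ‖L‖ ≤ 1 := hLn.trans (inv_le_one_of_one_le₀ (by linarith [m.cast_nonneg (α := ℝ)]))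
  have hcoe : (⇑((hscale m).2.toSchwartzMap (hscale m).1 - φ) : E → ℂ)
      = fun x => (w ∘ L) x * φ x := by
    ext y
    simp [hw, hL]
    ring
  rw [hcoe]
  have hmul := norm_iteratedFDeriv_mul_le (n := n) (N := ∞) (hws.comp L.contDiff) (φ.smooth ⊤) x
    (by exact_mod_cast le_top)
  have hD : ∀ i, ‖iteratedFDeriv ℝ i (w ∘ L) x‖ ≤ C i * ((m + 1 : ℝ)⁻¹ * ‖x‖) := by
    intro i
    rw [L.iteratedFDeriv_comp_right hws x (by exact_mod_cast le_top)]
    refine (ContinuousMultilinearMap.norm_compContinuousLinearMap_le _ _).trans ?_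
    simp only [Finset.prod_const, Finset.card_univ, Fintype.card_fin]
    calc _ ≤ (C i * ‖L x‖) * 1 := by
          gcongr
          · exact mul_nonneg (hC0 i) (norm_nonneg _)
          · exact hC i _
          · exact pow_le_one₀ (norm_nonneg _) hL1
      _ ≤ _ := by
          rw [mul_one]
          have := hC0 i
          gcongr
          exact (L.le_opNorm x).trans (by gcongr)
  calc ‖x‖ ^ k * ‖iteratedFDeriv ℝ n (fun x => (w ∘ L) x * φ x) x‖
      ≤ ‖x‖ ^ k * ∑ i ∈ Finset.range (n + 1), (n.choose i : ℝ) * ‖iteratedFDeriv ℝ i (w ∘ L) x‖ *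
          ‖iteratedFDeriv ℝ (n - i) φ x‖ := by gcongr
    _ = ∑ i ∈ Finset.range (n + 1), (n.choose i : ℝ) * ‖iteratedFDeriv ℝ i (w ∘ L) x‖ *
          (‖x‖ ^ k * ‖iteratedFDeriv ℝ (n - i) φ x‖) := by
        rw [Finset.mul_sum]; refine Finset.sum_congr rfl fun i _ => by ring
    _ ≤ ∑ i ∈ Finset.range (n + 1), (n.choose i : ℝ) * (C i * ((m + 1 : ℝ)⁻¹ * ‖x‖)) *
          (‖x‖ ^ k * ‖iteratedFDeriv ℝ (n - i) φ x‖) := by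
        gcongr with i _; exact hD i
    _ = ∑ i ∈ Finset.range (n + 1), (m + 1 : ℝ)⁻¹ * ((n.choose i : ℝ) * C i *
          (‖x‖ ^ (k + 1) * ‖iteratedFDeriv ℝ (n - i) φ x‖)) := by
        refine Finset.sum_congr rfl fun i _ => by ring
    _ ≤ ∑ i ∈ Finset.range (n + 1), (m + 1 : ℝ)⁻¹ * ((n.choose i : ℝ) * C i *
          SchwartzMap.seminorm ℝ (k + 1) (n - i) φ) := by
        gcongr with i _
        · exact mul_nonneg (by positivity) (hC0 i)
        · exact SchwartzMap.le_seminorm ℝ _ _ φ x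
    _ = (m + 1 : ℝ)⁻¹ * S := by rw [hS, Finset.mul_sum]

end Approx

section Landau

open MeasureTheory

variable {E : Type} [NormedAddCommGroup E] [NormedSpace ℝ E] [FiniteDimensional ℝ E]
  [MeasurableSpace E] [BorelSpace E] (μ : Measure E) [μ.IsAddHaarMeasure]

/-- Averages of translates of `φ` against the normalized kernel `c ^ n` on `s`. -/
noncomputable def peakAverage {F : Type} [NormedAddCommGroup F] [NormedSpace ℝ F]
    (s : Set E) (c : E → ℝ) (n : ℕ) (φ : E → F) (x : E) : F :=
  (∫ q in s, c q ^ n ∂μ)⁻¹ • ∫ q in s, c q ^ n • φ (x - q) ∂μ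

variable {s : Set E} {c : E → ℝ}

lemma peakAverage_eq_convolution (hs : IsCompact s) {F : Type} [NormedAddCommGroup F] [NormedSpace ℝ F]
    (n : ℕ) (φ : E → F) :
    peakAverage μ s c n φ = fun x => (∫ q in s, c q ^ n ∂μ)⁻¹ •
      convolution (s.indicator (fun q => c q ^ n)) φ (ContinuousLinearMap.lsmul ℝ ℝ) μ x := by
  ext x
  rw [peakAverage, convolution]
  refine congrArg _ ?_
  rw [← integral_indicator hs.measurableSet]
  refine integral_congr_ae (Eventually.of_forall fun q => ?_)
  by_cases hq : q ∈ s <;> simp [hq]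

lemma locallyIntegrable_indicator_pow (hs : IsCompact s) (hc : Continuous c) (n : ℕ) :
    LocallyIntegrable (s.indicator (fun q => c q ^ n)) μ := by
  refine Integrable.locallyIntegrable ?_
  rw [integrable_indicator_iff hs.measurableSet]
  exact (hc.pow n).continuousOn.integrableOn_compact hs

lemma contDiff_peakAverage (hs : IsCompact s) (hc : Continuous c) {F : Type}
    [NormedAddCommGroup F] [NormedSpace ℝ F]
    (n : ℕ) {φ : E → F} (hφ : ContDiff ℝ ∞ φ) (hφc : HasCompactSupport φ) :
    ContDiff ℝ ∞ (peakAverage μ s c n φ) := by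
  rw [peakAverage_eq_convolution μ hs]
  exact (hφc.contDiff_convolution_right _ (locallyIntegrable_indicator_pow μ hs hc n) hφ).const_smul _

lemma hasFDerivAt_peakAverage (hs : IsCompact s) (hc : Continuous c) {F : Type}
    [NormedAddCommGroup F] [NormedSpace ℝ F]
    [CompleteSpace F]
    (n : ℕ) {φ : E → F} (hφ : ContDiff ℝ ∞ φ) (hφc : HasCompactSupport φ) (x : E) :
    HasFDerivAt (peakAverage μ s c n φ) (peakAverage μ s c n (fderiv ℝ φ) x) x := by
  rw [peakAverage_eq_convolution μ hs, peakAverage_eq_convolution μ hs]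
  have h := (hφc.hasFDerivAt_convolution_right (ContinuousLinearMap.lsmul ℝ ℝ)
    (locallyIntegrable_indicator_pow μ hs hc n) (hφ.of_le (by exact_mod_cast le_top)) x).const_smul
    (∫ q in s, c q ^ n ∂μ)⁻¹
  refine HasFDerivAt.congr_fderiv h ?_
  refine congrArg (fun y : E →L[ℝ] F => (∫ q in s, c q ^ n ∂μ)⁻¹ • y)
    (integral_congr_ae (Eventually.of_forall fun q => ?_))
  ext v
  rfl

lemma peakAverage_uniform (hs : IsCompact s) (hc : Continuous c) (hpos : ∀ q ∈ s, 0 ≤ c q)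
    (hmax : ∀ q ∈ s, q ≠ 0 → c q < c 0) (hc0 : 0 < c 0) (hs0 : (0 : E) ∈ interior s) (l : ℕ) :
    ∀ {F : Type} [NormedAddCommGroup F] [NormedSpace ℝ F] [CompleteSpace F] (φ : E → F)
    (_ : ContDiff ℝ ∞ φ) (_ : HasCompactSupport φ) (ε : ℝ) (_ : 0 < ε),
    ∀ᶠ n in atTop, ∀ x, ‖iteratedFDeriv ℝ l (fun x => peakAverage μ s c n φ x - φ x) x‖ ≤ ε := by
  induction l with
  | zero =>
    intro F _ _ _ φ hφ hφc ε hε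
    obtain ⟨K, hK⟩ := ContDiff.lipschitzWith_of_hasCompactSupport hφc hφ (by simp)
    obtain ⟨M, hM⟩ := hφ.continuous.bounded_above_of_compact_support hφc
    set g : E → BoundedContinuousFunction E F := fun q =>
      BoundedContinuousFunction.ofNormedAddCommGroup (fun x => φ (x - q))
        (hφ.continuous.comp (by fun_prop)) M (fun x => hM _) with hg
    have hgc : Continuous g := by
      refine (LipschitzWith.of_dist_le_mul (K := K) fun p q => ?_).continuous
      refine (BoundedContinuousFunction.dist_le (by positivity)).2 fun x => ?_
      refine (hK.dist_le_mul _ _).trans ?_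
      rw [dist_sub_left]
    have hpeak := tendsto_setIntegral_pow_smul_of_unique_maximum_of_isCompact_of_continuousOn
      (μ := μ) (g := g) hs hc.continuousOn hmax hpos hc0 (subset_closure hs0) hgc.continuousOn
    filter_upwards [Metric.tendsto_atTop'.1 hpeak ε hε |>.choose_spec |> fun h =>
      (eventually_gt_atTop _).mono h] with n hn x
    rw [norm_iteratedFDeriv_zero, ← dist_eq_norm]
    refine le_trans (le_of_eq ?_) ((BoundedContinuousFunction.dist_coe_le_dist x).trans hn.le)
    congr 1
    · have hint : Integrable (fun q => c q ^ n • g q) (μ.restrict s) :=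
        (((hc.pow n).smul hgc).continuousOn.integrableOn_compact hs)
      have := (BoundedContinuousFunction.evalCLM ℝ x).integral_comp_comm hint
      simp only [BoundedContinuousFunction.evalCLM_apply] at this
      refine congrArg _ (Eq.trans ?_ this)
      rfl
    · simp [hg]
  | succ l ih =>
    intro F _ _ _ φ hφ hφc ε hε
    filter_upwards [ih (fderiv ℝ φ) (hφ.fderiv_right (by norm_cast)) (hφc.fderiv (𝕜 := ℝ)) ε hε]
      with n hn x
    rw [← norm_iteratedFDeriv_fderiv]
    convert hn x using 3
    ext1 w
    exact ((hasFDerivAt_peakAverage μ hs hc n hφ hφc w).sub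
      ((hφ.differentiable (by simp)) w).hasFDerivAt).fderiv

end Landau

section Density

open MeasureTheory

variable {E : Type}

/-- Kernels on `E × E` which are finite sums of products `a p * b q` with `a ∈ A` and `b`
continuous. -/
def IsSplitKernel [TopologicalSpace E] (A : Subalgebra ℂ (E → ℂ)) (K : E → E → ℂ) : Prop :=
  ∃ (ι : Type) (_ : Fintype ι) (a b : ι → E → ℂ), (∀ i, a i ∈ A) ∧ (∀ i, Continuous (b i)) ∧
    ∀ p q, K p q = ∑ i, a i p * b i q

lemma IsSplitKernel.mul [TopologicalSpace E] {A : Subalgebra ℂ (E → ℂ)} {K L : E → E → ℂ}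
    (hK : IsSplitKernel A K) (hL : IsSplitKernel A L) : IsSplitKernel A (fun p q => K p q * L p q) := by
  obtain ⟨ι, _, a, b, ha, hb, h⟩ := hK
  obtain ⟨κ, _, a', b', ha', hb', h'⟩ := hL
  refine ⟨ι × κ, inferInstance, fun i => a i.1 * a' i.2, fun i => b i.1 * b' i.2,
    fun i => A.mul_mem (ha _) (ha' _), fun i => (hb _).mul (hb' _), fun p q => ?_⟩
  beta_reduce
  rw [h, h', Finset.sum_mul_sum, Fintype.sum_prod_type]
  refine Finset.sum_congr rfl fun i _ => Finset.sum_congr rfl fun j _ => ?_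
  simp only [Pi.mul_apply]; ring

lemma IsSplitKernel.one [TopologicalSpace E] {A : Subalgebra ℂ (E → ℂ)} :
    IsSplitKernel A (fun _ _ => 1) :=
  ⟨Unit, inferInstance, fun _ => 1, fun _ => 1, fun _ => A.one_mem, fun _ => continuous_const,
    fun p q => by simp⟩

lemma IsSplitKernel.pow [TopologicalSpace E] {A : Subalgebra ℂ (E → ℂ)} {K : E → E → ℂ}
    (hK : IsSplitKernel A K) (n : ℕ) : IsSplitKernel A (fun p q => K p q ^ n) := by
  induction n with
  | zero => simpa using IsSplitKernel.one
  | succ n ih => simpa only [pow_succ] using ih.mul hK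

lemma IsSplitKernel.one_sub_mul [TopologicalSpace E] {A : Subalgebra ℂ (E → ℂ)} {K : E → E → ℂ}
    (hK : IsSplitKernel A K) (c : ℂ) : IsSplitKernel A (fun p q => 1 - c * K p q) := by
  obtain ⟨ι, _, a, b, ha, hb, h⟩ := hK
  refine ⟨Option ι, inferInstance, fun i => i.elim 1 a, fun i => i.elim 1 (fun j => (-c) • b j),
    ?_, ?_, fun p q => ?_⟩
  · rintro (_ | i)
    · exact A.one_mem
    · exact ha i
  · rintro (_ | i)
    · exact continuous_const
    · exact (hb i).const_smul (-c)
  · beta_reduce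
    rw [h, Fintype.sum_option, Finset.mul_sum, sub_eq_add_neg, ← Finset.sum_neg_distrib]
    simp only [Option.elim, Pi.one_apply, Pi.smul_apply, smul_eq_mul, mul_one]
    congr 1
    exact Finset.sum_congr rfl fun i _ => by ring

lemma IsSplitKernel.integral_mem [NormedAddCommGroup E] [MeasurableSpace E] [BorelSpace E]
    {μ : Measure E} [IsFiniteMeasureOnCompacts μ] {A : Subalgebra ℂ (E → ℂ)} {K : E → E → ℂ}
    (hK : IsSplitKernel A K) {u : E → ℂ} (hu : Continuous u) (huc : HasCompactSupport u) :
    (fun p => ∫ q, K p q * u q ∂μ) ∈ A := by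
  obtain ⟨ι, _, a, b, ha, hb, h⟩ := hK
  have : (fun p => ∫ q, K p q * u q ∂μ) = ∑ i, (∫ q, b i q * u q ∂μ) • a i := by
    ext p
    simp only [h, Finset.sum_mul, mul_assoc, Finset.sum_apply, Pi.smul_apply, smul_eq_mul]
    rw [integral_finsetSum]
    · refine Finset.sum_congr rfl fun i _ => ?_
      rw [integral_const_mul, mul_comm]
    · intro i _
      exact (((hb i).mul hu).integrable_of_hasCompactSupport huc.mul_left).const_mul _
  rw [this]
  exact A.sum_mem fun i _ => A.smul_mem (ha i) _

variable [NormedAddCommGroup E] [NormedSpace ℝ E] [FiniteDimensional ℝ E]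

/-- A tempered distribution vanishing on all products of a polynomial function and a cutoff of a
positive definite quadratic function vanishes. -/
theorem eq_zero_of_evalTest_polynomial_mul_cutoff (f : SchwartzMap E ℂ →L[ℂ] ℂ) (ν : E → ℝ)
    (hν : ContDiff ℝ ∞ ν) (hν0 : ν 0 = 0) {κ : ℝ} (hκ : 0 < κ) (hcoer : ∀ p, κ * ‖p‖ ^ 2 ≤ ν p)
    (A : Subalgebra ℂ (E → ℂ))
    (hsep : IsSplitKernel A (fun p q => (ν (p - q) : ℂ)))
    (hf : ∀ h : ℝ → ℂ, ContDiff ℝ ∞ h → (∃ R, ∀ r, R < r → h r = 0) → ∀ P ∈ A,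
      evalTest f (fun p => P p * h (ν p)) = 0) : f = 0 := by
  refine eq_zero_of_evalTest_eq_zero f fun u hu => ?_
  borelize E
  let μ : Measure E := Measure.addHaar
  have hbdd : ∀ r, Bornology.IsBounded {p | ν p ≤ r} := by
    intro r
    refine isBounded_iff_forall_norm_le.2 ⟨r / κ + 1, fun p hp => ?_⟩
    have h1 : κ * ‖p‖ ^ 2 ≤ r := (hcoer p).trans hp
    have h2 : ‖p‖ ^ 2 ≤ r / κ := by rw [le_div_iff₀ hκ]; linarith
    nlinarith [sq_nonneg (‖p‖ - 1)]
  have hcpt : ∀ r, IsCompact {p | ν p ≤ r} := fun r =>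
    Metric.isCompact_of_isClosed_isBounded (isClosed_le hν.continuous continuous_const) (hbdd r)
  have hνpos : ∀ p, p ≠ 0 → 0 < ν p := fun p hp =>
    lt_of_lt_of_le (by have := norm_pos_iff.2 hp; positivity) (hcoer p)
  -- the cutoff
  obtain ⟨ρ, hρ⟩ := hu.2.isCompact.exists_bound_of_continuousOn hν.continuous.continuousOn
  let η : ContDiffBump (0 : ℝ) :=
    ⟨|ρ| + 1, |ρ| + 2, by positivity, by linarith⟩
  set h : ℝ → ℂ := fun r => (η r : ℂ) with hh
  have hhs : ContDiff ℝ ∞ h := Complex.ofRealCLM.contDiff.comp η.contDiff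
  have hh0 : ∀ r, |ρ| + 2 < r → h r = 0 := by
    intro r hr
    have : η r = 0 := η.zero_of_le_dist (by
      rw [Real.dist_eq, sub_zero]; exact hr.le.trans (le_abs_self r))
    simp [hh, this]
  set χ : E → ℂ := fun p => h (ν p) with hχ
  have hχs : ContDiff ℝ ∞ χ := hhs.comp hν
  have hχsupp : ∀ p, χ p ≠ 0 → ν p ≤ |ρ| + 2 := fun p hp => by
    by_contra hlt
    exact hp (hh0 _ (not_le.1 hlt))
  have hχc : HasCompactSupport χ := HasCompactSupport.intro (hcpt (|ρ| + 2)) fun p hp => by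
    by_contra hne; exact hp (hχsupp p hne)
  have hχ1 : ∀ p, u p ≠ 0 → χ p = 1 := by
    intro p hp
    have h1 := hρ p (subset_tsupport _ hp)
    have : η (ν p) = 1 := η.one_of_mem_closedBall (by
      rw [mem_closedBall_zero_iff]
      exact h1.trans ((le_abs_self ρ).trans (le_add_of_nonneg_right zero_le_one)))
    simp [hχ, hh, this]
  obtain ⟨M', hM'⟩ := ((hcpt (|ρ| + 2)).prod hu.2.isCompact).exists_bound_of_continuousOn
    (f := fun z : E × E => ν (z.1 - z.2)) (hν.continuous.comp (by fun_prop)).continuousOn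
  set M : ℝ := |M'| + 1 with hM
  have hM0 : 0 < M := by positivity
  have hMp : ∀ p q, χ p ≠ 0 → u q ≠ 0 → ν (p - q) ≤ M := by
    intro p q hp hq
    have := hM' (p, q) ⟨hχsupp p hp, subset_tsupport _ hq⟩
    exact (le_abs_self _).trans (this.trans ((le_abs_self _).trans (by linarith)))
  set s : Set E := {p | ν p ≤ M} with hs
  set c : E → ℝ := fun q => 1 - M⁻¹ * ν q with hc
  have hcc : Continuous c := by have := hν.continuous; fun_prop
  have hpos : ∀ q ∈ s, 0 ≤ c q := by
    intro q hq
    have hq : ν q ≤ M := hq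
    have : M⁻¹ * ν q ≤ 1 := by rw [inv_mul_le_iff₀ hM0]; linarith
    simp only [hc]; linarith
  have hc0 : c 0 = 1 := by simp [hc, hν0]
  have hmax : ∀ q ∈ s, q ≠ 0 → c q < c 0 := by
    intro q _ hq0
    have := mul_pos (inv_pos.2 hM0) (hνpos q hq0)
    rw [hc0]; simp only [hc]; linarith
  have hs0 : (0 : E) ∈ interior s := by
    refine interior_maximal (s := s) (t := {p | ν p < M}) (fun p (hp : ν p < M) => le_of_lt hp)
      (isOpen_lt hν.continuous continuous_const) ?_
    simp [hν0, hM0]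
  have hsc : IsCompact s := hcpt M
  -- the approximations
  set P : ℕ → E → ℂ := fun n => peakAverage μ s c n u with hP
  have hPsupp : ∀ n p, P n p ≠ 0 → p ∈ (fun z : E × E => z.1 + z.2) '' (s ×ˢ tsupport u) := by
    intro n p hp
    by_contra hne
    apply hp
    have : ∀ q ∈ s, c q ^ n • u (p - q) = 0 := by
      intro q hq
      have : u (p - q) = 0 := by
        by_contra h0
        exact hne ⟨(q, p - q), ⟨hq, subset_tsupport _ h0⟩, by simp⟩
      simp [this]
    simp only [hP, peakAverage]
    rw [setIntegral_congr_fun hsc.measurableSet this]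
    simp
  have hKc : IsCompact ((fun z : E × E => z.1 + z.2) '' (s ×ˢ tsupport u)) :=
    (hsc.prod hu.2.isCompact).image (by fun_prop)
  have hPt : ∀ n, IsTest (P n) := fun n =>
    ⟨contDiff_peakAverage μ hsc hcc n hu.1 hu.2, HasCompactSupport.intro hKc fun p hp => by
      by_contra hne; exact hp (hPsupp n p hne)⟩
  have hPzero : ∀ n, evalTest f (fun p => χ p * P n p) = 0 := by
    intro n
    set Q : E → ℂ := fun p => (((∫ q in s, c q ^ n ∂μ : ℝ)⁻¹ : ℝ) : ℂ) *
      ∫ q, (1 - (M⁻¹ : ℂ) * (ν (p - q) : ℂ)) ^ n * u q ∂μ with hQ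
    have hQA : Q ∈ A := A.smul_mem (((hsep.one_sub_mul _).pow n).integral_mem hu.1.continuous hu.2) _
    have : (fun p => χ p * P n p) = fun p => Q p * h (ν p) := by
      ext p
      rw [mul_comm]
      by_cases hp : χ p = 0
      · have : h (ν p) = 0 := hp
        rw [hp, this, mul_zero, mul_zero]
      · refine congrArg (· * χ p) ?_
        simp only [hP, hQ, peakAverage, Complex.real_smul]
        refine congrArg _ ?_
        rw [← integral_indicator hsc.measurableSet,
          ← integral_sub_left_eq_self _ μ p]
        refine integral_congr_ae (Eventually.of_forall fun q => ?_)
        by_cases hq : u q = 0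
        · simp [Set.indicator_apply, hq]
        · have : p - q ∈ s := hMp p q hp hq
          simp [Set.indicator_of_mem this, hc]
    rw [this]
    exact hf h hhs ⟨_, hh0⟩ Q hQA
  have hχtemp : χ.HasTemperateGrowth := by
    have := (hχc.toSchwartzMap hχs).hasTemperateGrowth
    exact this
  set f' : SchwartzMap E ℂ →L[ℂ] ℂ := f.comp (SchwartzMap.smulLeftCLM ℂ χ) with hf'
  have hf'eq : ∀ w, IsTest w → evalTest f' w = evalTest f (fun p => χ p * w p) := by
    intro w hw
    rw [evalTest_eq f' (hw.2.toSchwartzMap hw.1) hw (fun _ => rfl)]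
    refine (evalTest_eq f _ (IsTest.mul hχs hw) fun p => ?_).symm
    exact SchwartzMap.smulLeftCLM_apply_apply hχtemp _ p
  have hχu : (fun p => χ p * u p) = u := by
    ext p
    by_cases hp : u p = 0
    · simp [hp]
    · simp [hχ1 p hp]
  obtain ⟨R, hR⟩ := hKc.isBounded.exists_norm_le
  obtain ⟨R', hR'⟩ := hu.2.isCompact.isBounded.exists_norm_le
  have hlim : Tendsto (fun n => evalTest f' (P n)) atTop (𝓝 (evalTest f' u)) := by
    refine tendsto_evalTest f' hPt hu (R := max (max R R') 0) (le_max_right _ _)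
      (Eventually.of_forall fun n p hp => ?_) ?_
    · have h1 : P n p = 0 := by
        by_contra hne
        exact absurd (hR p (hPsupp n p hne))
          (not_le.2 (((le_max_left _ _).trans (le_max_left _ _)).trans_lt hp))
      have h2 : u p = 0 := by
        by_contra hne
        exact absurd (hR' p (subset_tsupport _ hne))
          (not_le.2 (((le_max_right _ _).trans (le_max_left _ _)).trans_lt hp))
      rw [h1, h2]
    · intro l ε hε
      exact peakAverage_uniform μ hsc hcc hpos hmax (by rw [hc0]; exact one_pos) hs0 l u hu.1 hu.2 ε hε
  have hz : ∀ n, evalTest f' (P n) = 0 := fun n => by rw [hf'eq _ (hPt n), hPzero n]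
  simp only [hz] at hlim
  have := tendsto_nhds_unique hlim tendsto_const_nhds
  rw [hf'eq u hu, hχu] at this
  exact this

end Density

section Multilinear

variable {ι : Type} [DecidableEq ι] {V : Type} [AddCommGroup V] [Module ℝ V]

/-- The derivative at `0` of a multilinear map along an affine line. -/
lemma MultilinearMap.hasDerivAt_add_smul (T : MultilinearMap ℝ (fun _ : ι => V) ℂ) (s : Finset ι)
    (α : ι → V) (z : V) :
    HasDerivAt (fun ε : ℝ => T (fun i => if i ∈ s then α i + ε • z else α i))
      (∑ i ∈ s, T (Function.update α i z)) 0 := by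
  induction s using Finset.induction_on generalizing α with
  | empty => simpa using hasDerivAt_const (0 : ℝ) (T α)
  | insert j s hj ih =>
    have e : (fun ε : ℝ => T (fun i => if i ∈ insert j s then α i + ε • z else α i)) =
        fun ε => T (fun i => if i ∈ s then α i + ε • z else α i) +
          ε • T (fun i => if i ∈ s then (Function.update α j z) i + ε • z
            else (Function.update α j z) i) := by
      ext ε
      have e1 : (fun i => if i ∈ insert j s then α i + ε • z else α i) =
          Function.update (fun i => if i ∈ s then α i + ε • z else α i) j (α j + ε • z) := by
        ext i
        by_cases h : i = j
        · subst h; simp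
        · simp [h, Finset.mem_insert]
      have e2 : Function.update (fun i => if i ∈ s then α i + ε • z else α i) j (α j) =
          fun i => if i ∈ s then α i + ε • z else α i := by
        ext i
        by_cases h : i = j
        · subst h; simp [hj]
        · simp [h]
      have e3 : Function.update (fun i => if i ∈ s then α i + ε • z else α i) j z =
          fun i => if i ∈ s then (Function.update α j z) i + ε • z
            else (Function.update α j z) i := by
        ext i
        by_cases h : i = j
        · subst h; simp [hj]
        · simp [h]
      rw [e1, T.map_update_add, T.map_update_smul, e2, e3]
    rw [e, Finset.sum_insert hj, add_comm]
    refine (ih α).add ?_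
    have := (hasDerivAt_id (0 : ℝ)).smul (ih (Function.update α j z))
    refine this.congr_deriv ?_
    simp

lemma MultilinearMap.sum_update_eq_zero (T : MultilinearMap ℝ (fun _ : ι => V) ℂ) (s : Finset ι)
    (α : ι → V) (z : V) (h : ∀ ε : ℝ, T (fun i => if i ∈ s then α i + ε • z else α i) = 0) :
    ∑ i ∈ s, T (Function.update α i z) = 0 := by
  have h1 := T.hasDerivAt_add_smul s α z
  simp only [h] at h1
  exact h1.unique (hasDerivAt_const _ _)

variable [Fintype ι]

/-- A multilinear map which is symmetric in the slots of `P` and vanishes when all these slots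
have the same value vanishes. -/
lemma MultilinearMap.eq_zero_of_symmetric (T : MultilinearMap ℝ (fun _ : ι => V) ℂ) (P : Finset ι)
    (W : Submodule ℝ V) (e : ι → V)
    (hdiag : ∀ β ∈ W, T (fun i => if i ∈ P then β else e i) = 0)
    (hsymm : ∀ u : ι → V, (∀ i ∈ P, u i ∈ W) → (∀ i ∉ P, u i = e i) → ∀ i ∈ P, ∀ j ∈ P,
      T (u ∘ Equiv.swap i j) = T u)
    (u : ι → V) (hu : ∀ i ∈ P, u i ∈ W) (hue : ∀ i ∉ P, u i = e i) : T u = 0 := by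
  suffices H : ∀ A : Finset ι, A ⊆ P → ∀ u : ι → V, (∀ i ∈ P, u i ∈ W) → (∀ i ∉ P, u i = e i) →
      ∀ β ∈ W, T (fun i => if i ∈ P \ A then β else u i) = 0 by
    simpa using H P subset_rfl u hu hue 0 W.zero_mem
  intro A
  induction A using Finset.induction_on with
  | empty =>
    intro _ u hu hue β hβ
    rw [← hdiag β hβ]
    congr 1; ext i
    by_cases h : i ∈ P <;> simp [h, hue]
  | insert j A hj ih =>
    intro hA u hu hue β hβ
    have hjP : j ∈ P := hA (Finset.mem_insert_self _ _)
    have hAP : A ⊆ P := (Finset.subset_insert _ _).trans hA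
    set α : ι → V := fun i => if i ∈ P \ A then β else u i with hα
    have hz : u j ∈ W := hu j hjP
    have h1 := T.sum_update_eq_zero (P \ A) α (u j) (fun ε => by
      have := ih hAP u hu hue (β + ε • u j) (W.add_mem hβ (W.smul_mem _ hz))
      rw [← this]; congr 1; ext i
      by_cases h : i ∈ P \ A
      · simp only [if_pos h, hα]
      · simp only [if_neg h, hα])
    have hjm : j ∈ P \ A := by simp [hjP, hj]
    have h2 : ∀ i ∈ P \ A, T (Function.update α i (u j)) = T (Function.update α j (u j)) := by
      intro i hi
      have hiP : i ∈ P := (Finset.mem_sdiff.1 hi).1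
      have := hsymm (Function.update α j (u j)) ?_ ?_ i hiP j hjP
      · rw [← this]; congr 1; ext k
        simp only [Function.comp, Function.update_apply]
        have hαj : α j = β := by simp only [hα, if_pos hjm]
        have hαi : α i = β := by simp only [hα, if_pos hi]
        by_cases hki : k = i
        · subst hki; simp
        · by_cases hkj : k = j
          · subst hkj; simp only [Equiv.swap_apply_right]
            rw [if_neg hki, if_neg (fun h => hki h.symm), hαi, hαj]
          · rw [Equiv.swap_apply_of_ne_of_ne hki hkj, if_neg hki, if_neg hkj]
      · intro k hk
        simp only [Function.update_apply, hα]
        split_ifs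
        exacts [hz, hβ, hu k hk]
      · intro k hk
        have : k ≠ j := fun h => hk (h ▸ hjP)
        simp [this, hα, hk, hue]
    rw [Finset.sum_congr rfl h2, Finset.sum_const, nsmul_eq_mul, mul_eq_zero] at h1
    have h3 : ((P \ A).card : ℂ) ≠ 0 := by
      exact_mod_cast Finset.card_ne_zero_of_mem hjm
    rw [← h1.resolve_left h3]
    congr 1; ext k
    by_cases hk : k = j
    · subst hk; simp
    · simp [hα, hk, Finset.mem_sdiff, Finset.mem_insert]

/-- A combinatorial vanishing criterion, proved by a maximum principle. -/
lemma eq_zero_of_exchange (R : Finset ι) (G : (ι → Bool) → ι → ℂ)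
    (h0 : ∀ χ t β, G (Function.update χ t β) t = G χ t)
    (h1 : ∀ χ β, ∑ t ∈ R with χ t = β, G χ t = 0)
    (h3 : ∀ χ, ∀ a ∈ R, ∀ b ∈ R, ∀ s ∈ R, a ≠ s → b ≠ s → χ a = true → χ b = false →
      G χ s - G (Function.update (Function.update χ a false) b true) s
        + (G (Function.update (Function.update χ a false) s true) b - G (Function.update χ s false) b)
        + (G (Function.update (Function.update χ b true) s false) a - G (Function.update χ s true) a)
        = 0) (χ : ι → Bool) (s : ι) (hs : s ∈ R) : G χ s = 0 := by
  obtain ⟨χ₀, hmax⟩ := Finite.exists_max (fun χ : ι → Bool => ‖G χ s‖)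
  suffices H : G χ₀ s = 0 by
    have := hmax χ
    rw [H, norm_zero] at this
    exact norm_le_zero_iff.1 this
  clear χ
  set A : Finset ι := R.filter fun t => t ≠ s ∧ χ₀ t = true with hA
  set B : Finset ι := R.filter fun t => t ≠ s ∧ χ₀ t = false with hB
  have hAs : s ∉ A := by simp [hA]
  have hBs : s ∉ B := by simp [hB]
  have e1 : ∑ b ∈ B, G (Function.update χ₀ s false) b = - G χ₀ s := by
    have h := h1 (Function.update χ₀ s false) false
    have : (R.filter fun t => Function.update χ₀ s false t = false) = insert s B := by
      ext t; by_cases ht : t = s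
      · subst ht; simp [hs]
      · simp [hB, ht]
    rw [this, Finset.sum_insert hBs, h0] at h
    exact eq_neg_of_add_eq_zero_right h
  have e2 : ∑ a ∈ A, G (Function.update χ₀ s true) a = - G χ₀ s := by
    have h := h1 (Function.update χ₀ s true) true
    have : (R.filter fun t => Function.update χ₀ s true t = true) = insert s A := by
      ext t; by_cases ht : t = s
      · subst ht; simp [hs]
      · simp [hA, ht]
    rw [this, Finset.sum_insert hAs, h0] at h
    exact eq_neg_of_add_eq_zero_right h
  have e3 : ∀ a ∈ A, ∑ b ∈ B, G (Function.update (Function.update χ₀ a false) s true) b =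
      - G (Function.update χ₀ s true) a := by
    intro a ha
    obtain ⟨haR, has, hat⟩ := Finset.mem_filter.1 ha
    have h := h1 (Function.update (Function.update χ₀ a false) s true) false
    have haB : a ∉ B := by simp [hB, hat]
    have : (R.filter fun t => Function.update (Function.update χ₀ a false) s true t = false) =
        insert a B := by
      ext t; by_cases ht : t = s
      · subst ht; simp [Ne.symm has, hB]
      · by_cases hta : t = a
        · subst hta; simp [has, haR]
        · simp [hB, ht, hta]
    rw [this, Finset.sum_insert haB, Function.update_comm has, h0] at h
    rw [Function.update_comm has]
    exact eq_neg_of_add_eq_zero_right h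
  have e4 : ∀ b ∈ B, ∑ a ∈ A, G (Function.update (Function.update χ₀ b true) s false) a =
      - G (Function.update χ₀ s false) b := by
    intro b hb
    obtain ⟨hbR, hbs, hbt⟩ := Finset.mem_filter.1 hb
    have h := h1 (Function.update (Function.update χ₀ b true) s false) true
    have hbA : b ∉ A := by simp [hA, hbt]
    have : (R.filter fun t => Function.update (Function.update χ₀ b true) s false t = true) =
        insert b A := by
      ext t; by_cases ht : t = s
      · subst ht; simp [Ne.symm hbs, hA]
      · by_cases htb : t = b
        · subst htb; simp [hbs, hbR]
        · simp [hA, ht, htb]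
    rw [this, Finset.sum_insert hbA, Function.update_comm hbs, h0] at h
    rw [Function.update_comm hbs]
    exact eq_neg_of_add_eq_zero_right h
  have hsum : ∑ a ∈ A, ∑ b ∈ B,
      (G χ₀ s - G (Function.update (Function.update χ₀ a false) b true) s
        + (G (Function.update (Function.update χ₀ a false) s true) b
          - G (Function.update χ₀ s false) b)
        + (G (Function.update (Function.update χ₀ b true) s false) a
          - G (Function.update χ₀ s true) a)) = 0 := by
    refine Finset.sum_eq_zero fun a ha => Finset.sum_eq_zero fun b hb => ?_
    obtain ⟨haR, has, hat⟩ := Finset.mem_filter.1 ha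
    obtain ⟨hbR, hbs, hbt⟩ := Finset.mem_filter.1 hb
    exact h3 χ₀ a haR b hbR s hs has hbs hat hbt
  have e5 : ∑ a ∈ A, ∑ b ∈ B, G (Function.update (Function.update χ₀ b true) s false) a =
      G χ₀ s := by
    rw [Finset.sum_comm, Finset.sum_congr rfl e4, Finset.sum_neg_distrib, e1, neg_neg]
  have e6 : ∑ a ∈ A, ∑ b ∈ B, G (Function.update (Function.update χ₀ a false) s true) b =
      G χ₀ s := by
    rw [Finset.sum_congr rfl e3, Finset.sum_neg_distrib, e2, neg_neg]
  simp only [Finset.sum_add_distrib, Finset.sum_sub_distrib, e5, e6, e1, Finset.sum_const,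
    nsmul_eq_mul] at hsum
  rw [← Finset.mul_sum, e2] at hsum
  set k : ℕ := A.card
  set l : ℕ := B.card
  have hle : ‖∑ a ∈ A, ∑ b ∈ B, G (Function.update (Function.update χ₀ a false) b true) s‖ ≤
      k * (l * ‖G χ₀ s‖) := by
    refine (norm_sum_le_of_le _ (fun a _ => norm_sum_le_of_le _ fun b _ => hmax _)).trans ?_
    simp [k, l]
  have hkey : ((k * l + k + l + 2 : ℕ) : ℂ) * G χ₀ s =
      ∑ a ∈ A, ∑ b ∈ B, G (Function.update (Function.update χ₀ a false) b true) s := by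
    rw [← sub_eq_zero, ← hsum]; push_cast; ring
  rw [← hkey, norm_mul, Complex.norm_natCast] at hle
  push_cast at hle
  have h4 : 0 ≤ (k : ℝ) * ‖G χ₀ s‖ := by positivity
  have h5 : 0 ≤ (l : ℝ) * ‖G χ₀ s‖ := by positivity
  exact norm_le_zero_iff.1 (by linarith)

/-- A multilinear map which vanishes when its arguments take at most two values, and whose
antisymmetrization over any three slots vanishes, vanishes. -/
lemma MultilinearMap.eq_zero_of_antisymmetrization (T : MultilinearMap ℝ (fun _ : ι => V) ℂ)
    (hpair : ∀ (χ : ι → Bool) (x y : V), T (fun i => if χ i then x else y) = 0)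
    (hanti : ∀ (u : ι → V) (i j k : ι), i ≠ j → i ≠ k → j ≠ k → ∀ (x y z : V) (U : V → V → V → ℂ),
      (∀ a b c, U a b c =
        T (Function.update (Function.update (Function.update u i a) j b) k c)) →
      U x y z - U y x z + (U y z x - U x z y) + (U z x y - U z y x) = 0) : T = 0 := by
  suffices H : ∀ (O : Finset ι) (v : ι → V) (χ : ι → Bool) (x y : V),
      T (fun i => if i ∈ O then v i else if χ i then x else y) = 0 by
    ext u
    simpa using H Finset.univ u (fun _ => true) 0 0
  intro O
  induction O using Finset.induction_on with
  | empty => intro v χ x y; simpa using hpair χ x y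
  | insert s O hs ih =>
    intro v χ x y
    set U : (ι → Bool) → ι → V := fun χ i => if i ∈ O then v i else if χ i then x else y with hU
    have key := eq_zero_of_exchange Oᶜ (fun χ t => T (Function.update (U χ) t (v s))) ?_ ?_ ?_ χ s
      (Finset.mem_compl.2 hs)
    · rw [← key]
      congr 1; ext i
      by_cases h : i = s
      · subst h; simp
      · simp [hU, h, Finset.mem_insert]
    · intro χ t β
      congr 1; ext i
      by_cases h : i = t
      · subst h; simp
      · simp [hU, h]
    · intro χ β
      refine T.sum_update_eq_zero _ (U χ) (v s) fun ε => ?_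
      rw [← ih v χ (if β then x + ε • v s else x) (if β then y else y + ε • v s)]
      congr 1; ext i
      by_cases h : i ∈ O
      · simp [hU, h]
      · cases β <;> cases hi : χ i <;> simp [hU, h, hi]
    · intro χ a ha b hb c hc hac hbc hχa hχb
      have hab : a ≠ b := by rintro rfl; simp [hχa] at hχb
      have ha' := Finset.mem_compl.1 ha
      have hb' := Finset.mem_compl.1 hb
      have hc' := Finset.mem_compl.1 hc
      have h := hanti (U χ) a b c hab hac hbc x y (v s) _ (fun _ _ _ => rfl)
      rw [← h]
      congr 1; congr 1; congr 1
      all_goals congr 1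
      all_goals
        congr 1; ext i
        simp only [Function.update_apply, hU]
        by_cases hia : i = a
        · subst hia
          simp [hab, hac, ha', hχa]
        · by_cases hib : i = b
          · subst hib
            simp [hbc, hab.symm, hb', hχb]
          · by_cases hic : i = c
            · subst hic
              simp [hac.symm, hbc.symm, hc']
            · simp [hia, hib, hic]

end Multilinear

section Killed

variable {E : Type} [NormedAddCommGroup E] [NormedSpace ℝ E]

/-- The smooth functions `Q` such that `f` vanishes on all test functions `Q * w`, `w ∈ W`. -/
def killed (f : SchwartzMap E ℂ →L[ℂ] ℂ) (W : Set (E → ℂ)) : Submodule ℂ (E → ℂ) where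
  carrier := {Q | ContDiff ℝ ∞ Q ∧ ∀ w ∈ W, IsTest w → evalTest f (fun p => Q p * w p) = 0}
  add_mem' := by
    rintro P Q ⟨hP, hP'⟩ ⟨hQ, hQ'⟩
    refine ⟨hP.add hQ, fun w hw hw' => ?_⟩
    simp only [Pi.add_apply, add_mul]
    rw [evalTest_add f (.mul hP hw') (.mul hQ hw'), hP' w hw hw', hQ' w hw hw', add_zero]
  zero_mem' := by
    refine ⟨contDiff_const, fun w _ _ => ?_⟩
    simpa using evalTest_zero f
  smul_mem' := by
    rintro c P ⟨hP, hP'⟩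
    refine ⟨contDiff_const.mul hP, fun w hw hw' => ?_⟩
    simp only [Pi.smul_apply, smul_eq_mul, mul_assoc]
    rw [evalTest_const_mul f c (.mul hP hw'), hP' w hw hw', mul_zero]

lemma prod_mem_killed_of_span {f : SchwartzMap E ℂ →L[ℂ] ℂ} {W : Set (E → ℂ)}
    {G : Set (E →L[ℝ] ℂ)} {ι : Type} [DecidableEq ι] {s : Finset ι}
    (h : ∀ ℓ : ι → E →L[ℝ] ℂ, (∀ i ∈ s, ℓ i ∈ G) → (fun p => ∏ i ∈ s, ℓ i p) ∈ killed f W)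
    (ℓ : ι → E →L[ℝ] ℂ) (hℓ : ∀ i ∈ s, ℓ i ∈ Submodule.span ℂ G) :
    (fun p => ∏ i ∈ s, ℓ i p) ∈ killed f W := by
  suffices H : ∀ A : Finset ι, A ⊆ s → ∀ ℓ : ι → E →L[ℝ] ℂ, (∀ i ∈ A, ℓ i ∈ Submodule.span ℂ G) →
      (∀ i ∈ s, i ∉ A → ℓ i ∈ G) → (fun p => ∏ i ∈ s, ℓ i p) ∈ killed f W from
    H s subset_rfl ℓ hℓ fun i hi hi' => absurd hi hi'
  intro A
  induction A using Finset.induction_on with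
  | empty => exact fun _ ℓ _ h' => h ℓ fun i hi => h' i hi (Finset.notMem_empty _)
  | insert j A hj ih =>
    intro hA ℓ h1 h2
    have hjs : j ∈ s := hA (Finset.mem_insert_self _ _)
    have hprod : ∀ a : E →L[ℝ] ℂ, (fun p => ∏ i ∈ s, Function.update ℓ j a i p) =
        fun p => a p * ∏ i ∈ s.erase j, ℓ i p := by
      intro a; ext p
      rw [← Finset.mul_prod_erase s _ hjs]
      simp only [Function.update_self]
      congr 1
      exact Finset.prod_congr rfl fun i hi => by rw [Function.update_of_ne (Finset.ne_of_mem_erase hi)]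
    have key : ∀ a ∈ Submodule.span ℂ G,
        (fun p => a p * ∏ i ∈ s.erase j, ℓ i p) ∈ killed f W := by
      intro a ha
      induction ha using Submodule.span_induction with
      | mem a ha =>
        rw [← hprod a]
        refine ih ((Finset.subset_insert _ _).trans hA) _ ?_ ?_
        · intro i hi
          have : i ≠ j := fun h => hj (h ▸ hi)
          rw [Function.update_of_ne this]
          exact h1 i (Finset.mem_insert_of_mem hi)
        · intro i hi hiA
          by_cases hij : i = j
          · subst hij; simpa using ha
          · rw [Function.update_of_ne hij]
            exact h2 i hi (by simp [hij, hiA])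
      | zero => 
        refine (congrArg (· ∈ killed f W) ?_).mp (Submodule.zero_mem _)
        ext p; simp
      | add a b _ _ ha hb =>
        have := Submodule.add_mem _ ha hb
        refine (congrArg (· ∈ killed f W) ?_).mp this
        ext p; simp [add_mul]
      | smul c a _ ha =>
        have := Submodule.smul_mem _ c ha
        refine (congrArg (· ∈ killed f W) ?_).mp this
        ext p; simp [mul_assoc]
    rw [← Function.update_eq_self j ℓ, hprod]
    exact key _ (h1 j (Finset.mem_insert_self _ _))

/-- The functions `h (ν p) * Z p` where `h` is smooth and vanishes near `∞` and `Z ∈ 𝒵`. -/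
def cutoffs (ν : E → ℝ) (𝒵 : Submonoid (E → ℂ)) : Set (E → ℂ) :=
  {w | ∃ (h : ℝ → ℂ) (Z : E → ℂ), ContDiff ℝ ∞ h ∧ (∃ R, ∀ r, R < r → h r = 0) ∧ Z ∈ 𝒵 ∧
    w = fun p => h (ν p) * Z p}

lemma isTest_of_mem_cutoffs {ν : E → ℝ} (hν : ContDiff ℝ ∞ ν) (hc : ∀ r, IsCompact {p | ν p ≤ r})
    {𝒵 : Submonoid (E → ℂ)} (h𝒵 : ∀ Z ∈ 𝒵, ContDiff ℝ ∞ Z) {w : E → ℂ} (hw : w ∈ cutoffs ν 𝒵) :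
    IsTest w := by
  obtain ⟨h, Z, hh, ⟨R, hR⟩, hZ, rfl⟩ := hw
  refine ⟨(hh.comp hν).mul (h𝒵 Z hZ), HasCompactSupport.intro (hc R) fun p hp => ?_⟩
  rw [hR _ (not_le.1 hp), zero_mul]

/-- A smooth function vanishing near `∞` has a primitive vanishing near `∞`. -/
lemma exists_primitive {h : ℝ → ℂ} (hh : ContDiff ℝ ∞ h) (hR : ∃ R, ∀ r, R < r → h r = 0) :
    ∃ H : ℝ → ℂ, ContDiff ℝ ∞ H ∧ (∃ R, ∀ r, R < r → H r = 0) ∧ ∀ r, HasDerivAt H (h r) r := by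
  obtain ⟨R, hR⟩ := hR
  have hd : ∀ r, HasDerivAt (fun r => ∫ t in (R + 1)..r, h t) (h r) r := fun r =>
    intervalIntegral.integral_hasDerivAt_right (hh.continuous.intervalIntegrable _ _)
      (hh.continuous.stronglyMeasurableAtFilter _ _) hh.continuous.continuousAt
  refine ⟨_, ?_, ⟨R + 1, fun r hr => ?_⟩, hd⟩
  · rw [contDiff_infty_iff_deriv]
    refine ⟨fun r => (hd r).differentiableAt, ?_⟩
    rw [funext fun r => (hd r).deriv]
    exact hh
  · refine (intervalIntegral.integral_congr (g := fun _ => 0) fun t ht => ?_).trans (by simp)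
    rw [Set.uIcc_of_le hr.le] at ht
    exact hR t (by linarith [ht.1])

/-- If `f` is annihilated by the linear vector field `X` and by all products of `n` slots, then it
is annihilated by the products of the moment function of `X` and `n` slots. -/
lemma moment_mul_prod_mem_killed {f : SchwartzMap E ℂ →L[ℂ] ℂ} {ν : E → ℝ}
    (hν : ContDiff ℝ ∞ ν) (hc : ∀ r, IsCompact {p | ν p ≤ r})
    {𝒵 : Submonoid (E → ℂ)} (h𝒵 : ∀ Z ∈ 𝒵, ContDiff ℝ ∞ Z) (X : E →L[ℝ] E)
    (hX : ∀ φ : E → ℂ, IsTest φ → evalTest f (fun p => fderiv ℝ φ p (X p)) = 0)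
    (hXZ : ∀ Z ∈ 𝒵, ∀ p, fderiv ℝ Z p (X p) = 0)
    {S : Submodule ℂ (E →L[ℝ] ℂ)} (hXS : ∀ ℓ ∈ S, ℓ.comp X ∈ S)
    {ι : Type} [DecidableEq ι] {s : Finset ι}
    (h : ∀ ℓ : ι → E →L[ℝ] ℂ, (∀ i ∈ s, ℓ i ∈ S) →
      (fun p => ∏ i ∈ s, ℓ i p) ∈ killed f (cutoffs ν 𝒵))
    (ℓ : ι → E →L[ℝ] ℂ) (hℓ : ∀ i ∈ s, ℓ i ∈ S) :
    (fun p => (fderiv ℝ ν p (X p) : ℂ) * ∏ i ∈ s, ℓ i p) ∈ killed f (cutoffs ν 𝒵) := by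
  have hPs : ContDiff ℝ ∞ (fun p => ∏ i ∈ s, ℓ i p) := (h ℓ hℓ).1
  refine ⟨ContDiff.mul (Complex.ofRealCLM.contDiff.comp
    ((hν.fderiv_right (m := ∞) (by norm_cast)).clm_apply X.contDiff)) hPs, ?_⟩
  rintro w ⟨h₀, Z, hh, hR, hZ, rfl⟩ hw
  obtain ⟨H, hH, hHR, hHd⟩ := exists_primitive hh hR
  have hwH : (fun p => H (ν p) * Z p) ∈ cutoffs ν 𝒵 := ⟨H, Z, hH, hHR, hZ, rfl⟩
  have hwH' := isTest_of_mem_cutoffs hν hc h𝒵 hwH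
  have hφ : IsTest (fun p => (∏ i ∈ s, ℓ i p) * (H (ν p) * Z p)) := .mul hPs hwH'
  have key := hX _ hφ
  have hup : ∀ i ∈ s, ∀ p, (∏ j ∈ s, Function.update ℓ i ((ℓ i).comp X) j p) =
      (∏ j ∈ s.erase i, ℓ j p) * ℓ i (X p) := by
    intro i hi p
    rw [← Finset.prod_erase_mul s _ hi]
    simp only [Function.update_self, ContinuousLinearMap.comp_apply]
    congr 1
    exact Finset.prod_congr rfl fun j hj => by rw [Function.update_of_ne (Finset.ne_of_mem_erase hj)]
  have hkill : ∀ i ∈ s, (fun p => ∏ j ∈ s, Function.update ℓ i ((ℓ i).comp X) j p) ∈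
      killed f (cutoffs ν 𝒵) := by
    intro i hi
    refine h _ fun j hj => ?_
    by_cases hij : j = i
    · subst hij; simpa using hXS _ (hℓ j hj)
    · rw [Function.update_of_ne hij]; exact hℓ j hj
  have hder : (fun p => fderiv ℝ (fun p => (∏ i ∈ s, ℓ i p) * (H (ν p) * Z p)) p (X p)) =
      fun p => (∑ i ∈ s, (∏ j ∈ s, Function.update ℓ i ((ℓ i).comp X) j p) * (H (ν p) * Z p)) +
        ((fderiv ℝ ν p (X p) : ℂ) * ∏ i ∈ s, ℓ i p) * (h₀ (ν p) * Z p) := by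
    ext p
    have d1 : HasFDerivAt (fun p => ∏ i ∈ s, ℓ i p)
        (∑ i ∈ s, (∏ j ∈ s.erase i, ℓ j p) • (ℓ i)) p := by
      simpa [Finset.prod_fn] using HasFDerivAt.finsetProd (u := s) (x := p) fun i _ => (ℓ i).hasFDerivAt
    have d2 : HasFDerivAt (fun p => H (ν p)) _ p :=
      (hHd (ν p)).hasFDerivAt.comp p ((hν.differentiable (by simp)) p).hasFDerivAt
    have d3 : HasFDerivAt Z (fderiv ℝ Z p) p := (((h𝒵 Z hZ).differentiable (by simp)) p).hasFDerivAt
    have d4 : HasFDerivAt (fun p => (∏ i ∈ s, ℓ i p) * (H (ν p) * Z p)) _ p := d1.mul (d2.mul d3)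
    rw [d4.fderiv]
    simp only [_root_.add_apply, _root_.smul_apply, hXZ Z hZ p,
      _root_.sum_apply, ContinuousLinearMap.comp_apply, smul_eq_mul]
    rw [← Finset.sum_mul, Finset.sum_congr rfl fun i hi => hup i hi p]
    simp
    ring
  rw [hder, evalTest_add, evalTest_sum, Finset.sum_eq_zero, zero_add] at key
  · exact key
  · exact fun i hi => (hkill i hi).2 _ hwH hwH'
  · exact fun i hi => .mul (hkill i hi).1 hwH'
  · exact .sum s fun i hi => .mul (hkill i hi).1 hwH'
  · refine .mul (ContDiff.mul (Complex.ofRealCLM.contDiff.comp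
      ((hν.fderiv_right (m := ∞) (by norm_cast)).clm_apply X.contDiff)) hPs) hw

end Killed

section Slots

variable {E : Type} [NormedAddCommGroup E] [NormedSpace ℝ E]

/-- All products of `n` functionals in `S` are killed. -/
def SlotsKilled (f : SchwartzMap E ℂ →L[ℂ] ℂ) (W : Set (E → ℂ)) (S : Submodule ℂ (E →L[ℝ] ℂ))
    (n : ℕ) : Prop :=
  ∀ (ι : Type) [DecidableEq ι] (s : Finset ι), s.card = n → ∀ ℓ : ι → E →L[ℝ] ℂ,
    (∀ i ∈ s, ℓ i ∈ S) → (fun p => ∏ i ∈ s, ℓ i p) ∈ killed f W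

lemma contDiff_prod_clm {ι : Type} (s : Finset ι) (ℓ : ι → E →L[ℝ] ℂ) :
    ContDiff ℝ ∞ (fun p => ∏ i ∈ s, ℓ i p) := contDiff_prod fun i _ => (ℓ i).contDiff

variable {L V : Type} [AddCommGroup V] [Module ℝ V]

/-- The value of a distribution on products of functionals, as a multilinear map. -/
noncomputable def slotForm (f : SchwartzMap E ℂ →L[ℂ] ℂ) {w : E → ℂ} (hw : IsTest w)
    (lin : L → V →ₗ[ℝ] (E →L[ℝ] ℂ)) {ι : Type} [Fintype ι] (c : ι → L) :
    MultilinearMap ℝ (fun _ : ι => V) ℂ where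
  toFun u := evalTest f (fun p => (∏ i, lin (c i) (u i) p) * w p)
  map_update_add' u j a b := by
    rw [← evalTest_add f (.mul (contDiff_prod_clm _ _) hw) (.mul (contDiff_prod_clm _ _) hw)]
    congr 1; ext p
    simp only [← Finset.mul_prod_erase Finset.univ _ (Finset.mem_univ j), Function.update_self]
    have : ∀ v : V, ∏ i ∈ Finset.univ.erase j, lin (c i) (Function.update u j v i) p =
        ∏ i ∈ Finset.univ.erase j, lin (c i) (u i) p := fun v =>
      Finset.prod_congr rfl fun i hi => by rw [Function.update_of_ne (Finset.ne_of_mem_erase hi)]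
    rw [this, this, this, map_add, _root_.add_apply]
    ring
  map_update_smul' u j r a := by
    rw [Complex.real_smul, ← evalTest_const_mul f _ (.mul (contDiff_prod_clm _ _) hw)]
    congr 1; ext p
    simp only [← Finset.mul_prod_erase Finset.univ _ (Finset.mem_univ j), Function.update_self]
    have : ∀ v : V, ∏ i ∈ Finset.univ.erase j, lin (c i) (Function.update u j v i) p =
        ∏ i ∈ Finset.univ.erase j, lin (c i) (u i) p := fun v =>
      Finset.prod_congr rfl fun i hi => by rw [Function.update_of_ne (Finset.ne_of_mem_erase hi)]
    rw [this, this, map_smul, _root_.smul_apply, Complex.real_smul]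
    ring

lemma slotForm_apply (f : SchwartzMap E ℂ →L[ℂ] ℂ) {w : E → ℂ} (hw : IsTest w)
    (lin : L → V →ₗ[ℝ] (E →L[ℝ] ℂ)) {ι : Type} [Fintype ι] (c : ι → L) (u : ι → V) :
    slotForm f hw lin c u = evalTest f (fun p => (∏ i, lin (c i) (u i) p) * w p) := rfl

lemma slotsKilled_of_slotForm (f : SchwartzMap E ℂ →L[ℂ] ℂ) (W : Set (E → ℂ))
    (lin : L → V →ₗ[ℝ] (E →L[ℝ] ℂ))
    (hstep : ∀ (ι : Type) [DecidableEq ι] [Fintype ι],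
      (∀ m < Fintype.card ι,
        SlotsKilled f W (Submodule.span ℂ {ℓ | ∃ l v, ℓ = lin l v}) m) →
      ∀ (c : ι → L), ∀ w ∈ W, ∀ hw : IsTest w, slotForm f hw lin c = 0) (n : ℕ) :
    SlotsKilled f W (Submodule.span ℂ {ℓ | ∃ l v, ℓ = lin l v}) n := by
  induction n using Nat.strong_induction_on with
  | _ n ih =>
  intro ι _ s hs
  refine prod_mem_killed_of_span fun ℓ hℓ => ⟨contDiff_prod_clm _ _, fun w hw hw' => ?_⟩
  have hsub : ∀ i : s, ∃ l v, ℓ i = lin l v := fun i => hℓ i i.2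
  choose c u hcu using hsub
  have := congrArg (fun T => T u) (hstep s (by simpa [hs] using ih) c w hw hw')
  simp only [slotForm_apply, _root_.zero_apply] at this
  rw [← this]
  congr 1; ext p
  beta_reduce
  rw [← Finset.prod_coe_sort s]
  simp only [hcu]

variable [FiniteDimensional ℝ E]

/-- A distribution killing all products of functionals in `G`, against all cutoffs, vanishes. -/
theorem eq_zero_of_slotsKilled (f : SchwartzMap E ℂ →L[ℂ] ℂ) {μ : Type} [Fintype μ]
    (lam : μ → E →L[ℝ] ℝ) {κ : ℝ} (hκ : 0 < κ) (hcoer : ∀ p, κ * ‖p‖ ^ 2 ≤ ∑ m, lam m p ^ 2)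
    (𝒵 : Submonoid (E → ℂ)) (h𝒵 : ∀ Z ∈ 𝒵, ContDiff ℝ ∞ Z) (S : Submodule ℂ (E →L[ℝ] ℂ))
    (hlam : ∀ m, ∃ ℓ ∈ S, ∃ Z ∈ 𝒵, ∀ p, (lam m p : ℂ) = ℓ p + Z p)
    (hS : ∀ n, SlotsKilled f (cutoffs (fun p => ∑ m, lam m p ^ 2) 𝒵) S n) : f = 0 := by
  set ν : E → ℝ := fun p => ∑ m, lam m p ^ 2 with hνdef
  have hν : ContDiff ℝ ∞ ν := ContDiff.sum fun m _ => (lam m).contDiff.pow 2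
  have hc : ∀ r, IsCompact {p | ν p ≤ r} := by
    intro r
    refine Metric.isCompact_of_isClosed_isBounded (isClosed_le hν.continuous continuous_const) ?_
    refine isBounded_iff_forall_norm_le.2 ⟨r / κ + 1, fun p hp => ?_⟩
    have h1 : κ * ‖p‖ ^ 2 ≤ r := (hcoer p).trans hp
    have h2 : ‖p‖ ^ 2 ≤ r / κ := by rw [le_div_iff₀ hκ]; linarith
    nlinarith [sq_nonneg (‖p‖ - 1)]
  set gen : Set (E → ℂ) := (fun (ℓ : E →L[ℝ] ℂ) (p : E) => ℓ p) '' S ∪ 𝒵 with hgen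
  have hmem : ∀ m, (fun p => (lam m p : ℂ)) ∈ Algebra.adjoin ℂ gen := by
    intro m
    obtain ⟨ℓ, hℓ, Z, hZ, h⟩ := hlam m
    have h1 : (fun p => ℓ p) ∈ Algebra.adjoin ℂ gen :=
      Algebra.subset_adjoin (Or.inl ⟨ℓ, hℓ, rfl⟩)
    have h2 : Z ∈ Algebra.adjoin ℂ gen := Algebra.subset_adjoin (Or.inr hZ)
    have := add_mem h1 h2
    rwa [show (fun p => (lam m p : ℂ)) = (fun p => ℓ p) + Z from funext h]
  refine eq_zero_of_evalTest_polynomial_mul_cutoff f ν hν (by simp [hνdef]) hκ hcoer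
    (Algebra.adjoin ℂ gen) ?_ ?_
  · refine ⟨μ × Fin 3, inferInstance,
      fun i => ![(fun p => (lam i.1 p : ℂ)) ^ 2, fun p => (lam i.1 p : ℂ), 1] i.2,
      fun i => ![fun _ => 1, fun q => -2 * (lam i.1 q : ℂ), fun q => (lam i.1 q : ℂ) ^ 2] i.2,
      ?_, ?_, ?_⟩
    · rintro ⟨m, k⟩
      fin_cases k
      exacts [Subalgebra.pow_mem _ (hmem m) 2, hmem m, Subalgebra.one_mem _]
    · rintro ⟨m, k⟩
      fin_cases k
      · exact continuous_const
      · exact continuous_const.mul (Complex.continuous_ofReal.comp (lam m).continuous)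
      · exact (Complex.continuous_ofReal.comp (lam m).continuous).pow 2
    · intro p q
      rw [Fintype.sum_prod_type]
      simp only [hνdef, Complex.ofReal_sum]
      refine Finset.sum_congr rfl fun m _ => ?_
      simp [Fin.sum_univ_three]
      ring
  · intro h hh hR P hP
    rw [← Subalgebra.mem_toSubmodule, Algebra.adjoin_eq_span] at hP
    have hclos : ∀ Q ∈ Submonoid.closure gen, ∃ (l : List (E →L[ℝ] ℂ)) (Z : E → ℂ),
        (∀ ℓ ∈ l, ℓ ∈ S) ∧ Z ∈ 𝒵 ∧ ∀ p, Q p = (l.map fun ℓ => ℓ p).prod * Z p := by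
      intro Q hQ
      induction hQ using Submonoid.closure_induction with
      | mem Q hQ =>
        rcases hQ with ⟨ℓ, hℓ, rfl⟩ | hQ
        · exact ⟨[ℓ], 1, by simpa using hℓ, 𝒵.one_mem, by simp⟩
        · exact ⟨[], Q, by simp, hQ, by simp⟩
      | one => exact ⟨[], 1, by simp, 𝒵.one_mem, by simp⟩
      | mul P Q _ _ hP hQ =>
        obtain ⟨l, Z, hl, hZ, h⟩ := hP
        obtain ⟨l', Z', hl', hZ', h'⟩ := hQ
        refine ⟨l ++ l', Z * Z', ?_, 𝒵.mul_mem hZ hZ', fun p => ?_⟩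
        · intro ℓ hℓ
          rcases List.mem_append.1 hℓ with h | h
          exacts [hl _ h, hl' _ h]
        · simp [h, h']; ring
    suffices H : ContDiff ℝ ∞ P ∧ evalTest f (fun p => P p * h (ν p)) = 0 from H.2
    have hw1 : IsTest (fun p => h (ν p)) := by
      refine isTest_of_mem_cutoffs hν hc h𝒵 ⟨h, 1, hh, hR, 𝒵.one_mem, ?_⟩
      ext p; simp
    induction hP using Submodule.span_induction with
    | mem Q hQ =>
      obtain ⟨l, Z, hl, hZ, hQ⟩ := hclos Q hQ
      have hprod : ∀ p, (l.map fun ℓ => ℓ p).prod = ∏ i : Fin l.length, l.get i p := by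
        intro p
        rw [← Fin.prod_univ_fun_getElem]; rfl
      have hw : (fun p => h (ν p) * Z p) ∈ cutoffs ν 𝒵 := ⟨h, Z, hh, hR, hZ, rfl⟩
      have hk := hS l.length (Fin l.length) Finset.univ (by simp) (fun i => l.get i)
        (fun i _ => hl _ (List.get_mem _ _))
      have hQ' : Q = fun p => (∏ i : Fin l.length, l.get i p) * Z p := by
        ext p; rw [hQ, hprod]
      refine ⟨hQ' ▸ hk.1.mul (h𝒵 Z hZ), ?_⟩
      rw [← hk.2 _ hw (isTest_of_mem_cutoffs hν hc h𝒵 hw)]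
      congr 1; ext p
      rw [hQ']; ring
    | zero =>
      refine ⟨contDiff_const, ?_⟩
      simpa using evalTest_zero f
    | add P Q _ _ hP hQ =>
      refine ⟨hP.1.add hQ.1, ?_⟩
      simp only [Pi.add_apply, add_mul]
      rw [evalTest_add f (.mul hP.1 hw1) (.mul hQ.1 hw1), hP.2, hQ.2, add_zero]
    | smul c P _ hP =>
      refine ⟨contDiff_const.mul hP.1, ?_⟩
      simp only [Pi.smul_apply, smul_eq_mul, mul_assoc]
      rw [evalTest_const_mul f c (.mul hP.1 hw1), hP.2, mul_zero]

end Slots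

section Pairs

lemma IsTest.comp_of_leftInverse {E : Type} [NormedAddCommGroup E] [NormedSpace ℝ E] {u : E → ℂ}
    (hu : IsTest u) {φ ψ : E → E} (hφ : ContDiff ℝ ∞ φ) (hψ : Continuous ψ)
    (h : ∀ p, ψ (φ p) = p) : IsTest (fun p => u (φ p)) := by
  refine ⟨hu.1.comp hφ, HasCompactSupport.intro (hu.2.isCompact.image hψ) fun p hp => ?_⟩
  by_contra hne
  exact hp ⟨φ p, subset_tsupport _ hne, h p⟩

variable {𝕂 : Type} [RCLike 𝕂]

/-- The space of pairs of `2 × 2` matrices. -/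
def MatPair (𝕂 : Type) : Type := Matrix (Fin 2) (Fin 2) 𝕂 × Matrix (Fin 2) (Fin 2) 𝕂

noncomputable instance : NormedAddCommGroup (MatPair 𝕂) :=
  inferInstanceAs (NormedAddCommGroup (Matrix (Fin 2) (Fin 2) 𝕂 × Matrix (Fin 2) (Fin 2) 𝕂))

noncomputable instance : NormedSpace ℝ (MatPair 𝕂) :=
  inferInstanceAs (NormedSpace ℝ (Matrix (Fin 2) (Fin 2) 𝕂 × Matrix (Fin 2) (Fin 2) 𝕂))

instance : FiniteDimensional ℝ (MatPair 𝕂) := by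
  have : FiniteDimensional ℝ (Matrix (Fin 2) (Fin 2) 𝕂) :=
    inferInstanceAs (FiniteDimensional ℝ (Fin 2 → Fin 2 → 𝕂))
  exact Module.Finite.prod

instance : ProperSpace (MatPair 𝕂) := FiniteDimensional.proper ℝ _

namespace MatPair

@[simp] lemma fst_add (p q : MatPair 𝕂) : (p + q).1 = p.1 + q.1 := rfl
@[simp] lemma snd_add (p q : MatPair 𝕂) : (p + q).2 = p.2 + q.2 := rfl
@[simp] lemma fst_sub (p q : MatPair 𝕂) : (p - q).1 = p.1 - q.1 := rfl
@[simp] lemma snd_sub (p q : MatPair 𝕂) : (p - q).2 = p.2 - q.2 := rfl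
@[simp] lemma fst_smul (r : ℝ) (p : MatPair 𝕂) : (r • p).1 = r • p.1 := rfl
@[simp] lemma snd_smul (r : ℝ) (p : MatPair 𝕂) : (r • p).2 = r • p.2 := rfl

/-- A linear map between matrices, applied to both members of a pair. -/
noncomputable def map {𝕃 : Type} [RCLike 𝕃]
    (A : Matrix (Fin 2) (Fin 2) 𝕂 →ₗ[ℝ] Matrix (Fin 2) (Fin 2) 𝕃) : MatPair 𝕂 →L[ℝ] MatPair 𝕃 :=
  LinearMap.toContinuousLinearMap
    { toFun := fun p => (A p.1, A p.2)
      map_add' := fun p q => Prod.ext (map_add A p.1 q.1) (map_add A p.2 q.2)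
      map_smul' := fun r p => Prod.ext (map_smul A r p.1) (map_smul A r p.2) }

@[simp] lemma fst_map {𝕃 : Type} [RCLike 𝕃]
    (A : Matrix (Fin 2) (Fin 2) 𝕂 →ₗ[ℝ] Matrix (Fin 2) (Fin 2) 𝕃) (p : MatPair 𝕂) :
    (map A p).1 = A p.1 := rfl

@[simp] lemma snd_map {𝕃 : Type} [RCLike 𝕃]
    (A : Matrix (Fin 2) (Fin 2) 𝕂 →ₗ[ℝ] Matrix (Fin 2) (Fin 2) 𝕃) (p : MatPair 𝕂) :
    (map A p).2 = A p.2 := rfl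

end MatPair

/-- An entry of the first (`l = false`) or second (`l = true`) matrix, as a linear functional. -/
noncomputable def entry (l : Bool) (i j : Fin 2) : MatPair 𝕂 →L[ℝ] 𝕂 :=
  LinearMap.toContinuousLinearMap
    { toFun := fun p => if l then p.2 i j else p.1 i j
      map_add' := fun p q => by cases l <;> rfl
      map_smul' := fun r p => by cases l <;> rfl }

@[simp] lemma entry_false (i j : Fin 2) (p : MatPair 𝕂) : entry false i j p = p.1 i j := rfl
@[simp] lemma entry_true (i j : Fin 2) (p : MatPair 𝕂) : entry true i j p = p.2 i j := rfl

/-- The real coordinates of a pair of matrices. -/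
noncomputable def realCoord (m : Bool × Bool × Fin 2 × Fin 2) : MatPair 𝕂 →L[ℝ] ℝ :=
  (if m.1 then RCLike.imCLM else RCLike.reCLM).comp (entry m.2.1 m.2.2.1 m.2.2.2)

/-- The sum of the squares of the absolute values of all entries. -/
noncomputable def sqNorm (p : MatPair 𝕂) : ℝ := ∑ m, realCoord m p ^ 2

lemma sqNorm_eq (p : MatPair 𝕂) : sqNorm p =
    ∑ i, ∑ j, (RCLike.normSq (p.1 i j) + RCLike.normSq (p.2 i j)) := by
  simp only [sqNorm, Fintype.sum_prod_type, Fintype.sum_bool, realCoord, RCLike.normSq_apply,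
    Fin.sum_univ_two]
  simp
  ring

lemma norm_sq_le_sqNorm (p : MatPair 𝕂) : ‖p‖ ^ 2 ≤ sqNorm p := by
  have hn : ∀ l i j, ‖entry l i j p‖ ^ 2 ≤ sqNorm p := by
    intro l i j
    rw [← RCLike.normSq_eq_def', sqNorm_eq]
    have h1 := fun i j => RCLike.normSq_nonneg (p.1 i j)
    have h2 := fun i j => RCLike.normSq_nonneg (p.2 i j)
    simp only [Fin.sum_univ_two]
    have := h1 0 0; have := h1 0 1; have := h1 1 0; have := h1 1 1
    have := h2 0 0; have := h2 0 1; have := h2 1 0; have := h2 1 1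
    fin_cases i <;> fin_cases j <;> cases l <;> simp <;> linarith
  have h0 : 0 ≤ sqNorm p := le_trans (by positivity) (hn false 0 0)
  have hle : ‖p‖ ≤ Real.sqrt (sqNorm p) := by
    refine norm_prod_le_iff.2 ⟨?_, ?_⟩ <;>
      refine (Matrix.norm_le_iff (Real.sqrt_nonneg _)).2 fun i j => Real.le_sqrt_of_sq_le ?_
    exacts [hn false i j, hn true i j]
  calc ‖p‖ ^ 2 ≤ Real.sqrt (sqNorm p) ^ 2 := by gcongr
    _ = sqNorm p := Real.sq_sqrt h0

lemma contDiff_sqNorm : ContDiff ℝ ∞ (sqNorm : MatPair 𝕂 → ℝ) :=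
  ContDiff.sum fun m _ => (realCoord m).contDiff.pow 2

lemma isCompact_sqNorm_le (r : ℝ) : IsCompact {p : MatPair 𝕂 | sqNorm p ≤ r} := by
  refine Metric.isCompact_of_isClosed_isBounded
    (isClosed_le contDiff_sqNorm.continuous continuous_const) ?_
  refine isBounded_iff_forall_norm_le.2 ⟨r + 1, fun p hp => ?_⟩
  have := (norm_sq_le_sqNorm p).trans hp
  nlinarith [sq_nonneg (‖p‖ - 1)]

lemma fderiv_sqNorm (p v : MatPair 𝕂) :
    fderiv ℝ sqNorm p v = ∑ m, 2 * realCoord m p * realCoord m v := by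
  have h : HasFDerivAt (sqNorm : MatPair 𝕂 → ℝ) _ p :=
    HasFDerivAt.fun_sum fun m _ => ((realCoord m).hasFDerivAt (x := p)).pow 2
  rw [h.fderiv]
  simp

/-- The vector field of the infinitesimal conjugation by `N`. -/
noncomputable def bracket (N : Matrix (Fin 2) (Fin 2) 𝕂) : MatPair 𝕂 →L[ℝ] MatPair 𝕂 :=
  MatPair.map (LinearMap.mulLeft ℝ N - LinearMap.mulRight ℝ N)

@[simp] lemma fst_bracket (N : Matrix (Fin 2) (Fin 2) 𝕂) (p : MatPair 𝕂) :
    (bracket N p).1 = N * p.1 - p.1 * N := rfl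

@[simp] lemma snd_bracket (N : Matrix (Fin 2) (Fin 2) 𝕂) (p : MatPair 𝕂) :
    (bracket N p).2 = N * p.2 - p.2 * N := rfl

/-- The map `(x, y) ↦ (g * x * k, g * y * k)`. -/
noncomputable def sandwich (g k : Matrix (Fin 2) (Fin 2) 𝕂) : MatPair 𝕂 →L[ℝ] MatPair 𝕂 :=
  MatPair.map (LinearMap.mulRight ℝ k ∘ₗ LinearMap.mulLeft ℝ g)

@[simp] lemma fst_sandwich (g k : Matrix (Fin 2) (Fin 2) 𝕂) (p : MatPair 𝕂) :
    (sandwich g k p).1 = g * p.1 * k := rfl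

@[simp] lemma snd_sandwich (g k : Matrix (Fin 2) (Fin 2) 𝕂) (p : MatPair 𝕂) :
    (sandwich g k p).2 = g * p.2 * k := rfl

/-- Simultaneous transposition. -/
noncomputable def pairTranspose : MatPair 𝕂 →L[ℝ] MatPair 𝕂 :=
  MatPair.map (Matrix.transposeLinearEquiv (Fin 2) (Fin 2) ℝ 𝕂).toLinearMap

@[simp] lemma fst_pairTranspose (p : MatPair 𝕂) : (pairTranspose p).1 = p.1ᵀ := rfl

@[simp] lemma snd_pairTranspose (p : MatPair 𝕂) : (pairTranspose p).2 = p.2ᵀ := rfl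

/-- The smooth functions of the two traces. -/
def traceFunctions (𝕂 : Type) [RCLike 𝕂] : Submonoid (MatPair 𝕂 → ℂ) where
  carrier := {Z | ContDiff ℝ ∞ Z ∧ ∀ p q : MatPair 𝕂, p.1.trace = q.1.trace →
    p.2.trace = q.2.trace → Z p = Z q}
  one_mem' := ⟨contDiff_const, fun _ _ _ _ => rfl⟩
  mul_mem' := fun {Y Z} hY hZ => ⟨hY.1.mul hZ.1, fun p q h1 h2 => by
    simp only [Pi.mul_apply, hY.2 p q h1 h2, hZ.2 p q h1 h2]⟩

lemma fderiv_bracket_eq_zero {Z : MatPair 𝕂 → ℂ} (hZ : Z ∈ traceFunctions 𝕂)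
    (N : Matrix (Fin 2) (Fin 2) 𝕂) (p : MatPair 𝕂) : fderiv ℝ Z p (bracket N p) = 0 := by
  have h1 : HasDerivAt (fun t : ℝ => p + t • bracket N p) (bracket N p) 0 := by
    simpa using ((hasDerivAt_id (0 : ℝ)).smul_const (bracket N p)).const_add p
  have h2 : HasFDerivAt Z (fderiv ℝ Z p) (p + (0 : ℝ) • bracket N p) := by
    rw [zero_smul, add_zero]
    exact ((hZ.1.differentiable (by simp)) p).hasFDerivAt
  have h3 := h2.comp_hasDerivAt (0 : ℝ) h1
  have h4 : (Z ∘ fun t : ℝ => p + t • bracket N p) = fun _ => Z p := by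
    ext t
    refine hZ.2 _ _ ?_ ?_ <;>
      simp [Matrix.trace_add, Matrix.trace_smul, Matrix.trace_sub, Matrix.trace_mul_comm N]
  rw [h4] at h3
  exact h3.unique (hasDerivAt_const _ _)

/-- Invariance under simultaneous conjugation. -/
def ConjInvariant (f : SchwartzMap (MatPair 𝕂) ℂ →L[ℂ] ℂ) : Prop :=
  ∀ g : Matrix (Fin 2) (Fin 2) 𝕂, IsUnit g.det → ∀ φ φ' : SchwartzMap (MatPair 𝕂) ℂ,
    (∀ p, φ' p = φ (sandwich g g⁻¹ p)) → f φ' = f φ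

/-- Anti-invariance under simultaneous transposition. -/
def TransposeSkew (f : SchwartzMap (MatPair 𝕂) ℂ →L[ℂ] ℂ) : Prop :=
  ∀ φ φ' : SchwartzMap (MatPair 𝕂) ℂ, (∀ p, φ' p = φ (pairTranspose p)) → f φ' = - f φ

variable {f : SchwartzMap (MatPair 𝕂) ℂ →L[ℂ] ℂ}

lemma sandwich_sandwich {g k : Matrix (Fin 2) (Fin 2) 𝕂} (hkg : k * g = 1) (p : MatPair 𝕂) :
    sandwich k g (sandwich g k p) = p := by
  have : ∀ x : Matrix (Fin 2) (Fin 2) 𝕂, k * (g * x * k) * g = x := fun x => by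
    rw [show k * (g * x * k) * g = (k * g) * x * (k * g) by simp only [mul_assoc], hkg]; simp
  exact Prod.ext (this p.1) (this p.2)

lemma isTest_sandwich {g k : Matrix (Fin 2) (Fin 2) 𝕂} (hgk : g * k = 1) {u : MatPair 𝕂 → ℂ}
    (hu : IsTest u) : IsTest (fun p => u (sandwich g k p)) :=
  hu.comp_of_leftInverse (sandwich g k).contDiff (sandwich k g).continuous
    (sandwich_sandwich (mul_eq_one_comm.1 hgk))

lemma ConjInvariant.evalTest_sandwich (hf : ConjInvariant f) {g k : Matrix (Fin 2) (Fin 2) 𝕂}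
    (hgk : g * k = 1) {u : MatPair 𝕂 → ℂ} (hu : IsTest u) :
    evalTest f (fun p => u (sandwich g k p)) = evalTest f u := by
  have hu' := isTest_sandwich hgk hu
  have hdet : IsUnit g.det := by
    rw [← Matrix.isUnit_iff_isUnit_det]
    exact IsUnit.of_mul_eq_one k hgk
  rw [evalTest_eq f (hu.2.toSchwartzMap hu.1) hu (fun _ => rfl),
    evalTest_eq f (hu'.2.toSchwartzMap hu'.1) hu' (fun _ => rfl)]
  refine hf g hdet _ _ fun p => ?_
  rw [Matrix.inv_eq_right_inv hgk]; rfl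

lemma evalTest_reflection (hf : ConjInvariant f) (hf' : TransposeSkew f)
    {g k : Matrix (Fin 2) (Fin 2) 𝕂} (hgk : g * k = 1) {u : MatPair 𝕂 → ℂ} (hu : IsTest u)
    (h : ∀ p : MatPair 𝕂, u (sandwich g k (pairTranspose p)) = u p) : evalTest f u = 0 := by
  have hv := isTest_sandwich hgk hu
  have h1 := hf.evalTest_sandwich hgk hu
  have h2 : evalTest f u = - evalTest f (fun p => u (sandwich g k p)) := by
    rw [evalTest_eq f (hu.2.toSchwartzMap hu.1) hu (fun _ => rfl),
      evalTest_eq f (hv.2.toSchwartzMap hv.1) hv (fun _ => rfl)]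
    exact hf' _ _ fun p => (h p).symm
  rw [h1] at h2
  exact self_eq_neg.1 h2

lemma sandwich_unipotent (N : Matrix (Fin 2) (Fin 2) 𝕂) (t : ℝ) (p : MatPair 𝕂) :
    sandwich (1 + t • N) (1 - t • N) p = p + t • bracket N p - t ^ 2 • sandwich N N p := by
  have : ∀ x : Matrix (Fin 2) (Fin 2) 𝕂, (1 + t • N) * x * (1 - t • N) =
      x + t • (N * x - x * N) - t ^ 2 • (N * x * N) := fun x => by
    simp only [mul_sub, add_mul, mul_assoc, smul_sub, pow_two, smul_smul, one_mul, mul_one,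
      Matrix.mul_smul, Matrix.smul_mul]
    abel
  exact Prod.ext (this p.1) (this p.2)

lemma ConjInvariant.evalTest_bracket (hf : ConjInvariant f) {N : Matrix (Fin 2) (Fin 2) 𝕂}
    (hN : N * N = 0) (φ : MatPair 𝕂 → ℂ) (hφ : IsTest φ) :
    evalTest f (fun p => fderiv ℝ φ p (bracket N p)) = 0 := by
  have hgk : ∀ t : ℝ, (1 + t • N) * (1 - t • N) = 1 := fun t => by
    simp [mul_sub, add_mul, hN]
  refine evalTest_fderiv_flow_eq_zero f
    (fun t p => sandwich (1 + t • N) (1 - t • N) p) _ ?_ ?_ ?_ ?_ ?_ hφ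
  · simp only [sandwich_unipotent]
    exact (contDiff_snd.add (contDiff_fst.smul ((bracket N).contDiff.comp contDiff_snd))).sub
      ((contDiff_fst.pow 2).smul ((sandwich N N).contDiff.comp contDiff_snd))
  · intro p
    rw [sandwich_unipotent]
    simp
  · intro t p
    rw [neg_smul, ← sub_eq_add_neg, sub_neg_eq_add]
    exact sandwich_sandwich (mul_eq_one_comm.1 (hgk t)) p
  · intro p
    simp only [sandwich_unipotent]
    have h1 := ((hasDerivAt_id (0 : ℝ)).smul_const (bracket N p)).const_add p
    have h2 := ((hasDerivAt_id (0 : ℝ)).pow 2).smul_const (sandwich N N p)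
    convert h1.sub h2 using 1
    · rfl
    · simp
  · intro t u hu _
    exact hf.evalTest_sandwich (hgk t) hu

end Pairs

section Slots

variable {E : Type} [NormedAddCommGroup E] [NormedSpace ℝ E] {L : Type}

/-- The real linear combinations of three functionals carrying the same label. -/
noncomputable def linComb (coord : L → Fin 3 → E →L[ℝ] ℂ) (l : L) :
    (Fin 3 → ℝ) →ₗ[ℝ] (E →L[ℝ] ℂ) :=
  ∑ a, (LinearMap.proj a).smulRight (coord l a)

@[simp] lemma linComb_apply (coord : L → Fin 3 → E →L[ℝ] ℂ) (l : L) (v : Fin 3 → ℝ) (p : E) :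
    linComb coord l v p = ∑ a, v a * coord l a p := by
  simp [linComb, Fin.sum_univ_three]

/-- The complex span of a family of functionals. -/
noncomputable abbrev slots (coord : L → Fin 3 → E →L[ℝ] ℂ) : Submodule ℂ (E →L[ℝ] ℂ) :=
  Submodule.span ℂ {ℓ | ∃ l v, ℓ = linComb coord l v}

lemma linComb_mem_slots (coord : L → Fin 3 → E →L[ℝ] ℂ) (l : L) (v : Fin 3 → ℝ) :
    linComb coord l v ∈ slots coord := Submodule.subset_span ⟨l, v, rfl⟩

lemma coord_mem_slots (coord : L → Fin 3 → E →L[ℝ] ℂ) (l : L) (a : Fin 3) :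
    coord l a ∈ slots coord := by
  convert linComb_mem_slots coord l (Pi.single a 1) using 1
  ext p
  rw [linComb_apply, Finset.sum_eq_single a (fun b _ hb => by simp [hb]) (by simp)]
  simp

lemma comp_mem_slots {coord : L → Fin 3 → E →L[ℝ] ℂ} {X : E →L[ℝ] E}
    (hX : ∀ l a, (coord l a).comp X ∈ slots coord) {ℓ : E →L[ℝ] ℂ} (hℓ : ℓ ∈ slots coord) :
    ℓ.comp X ∈ slots coord := by
  induction hℓ using Submodule.span_induction with
  | mem ℓ h =>
    obtain ⟨l, v, rfl⟩ := h
    have : (linComb coord l v).comp X = ∑ a, (v a : ℂ) • (coord l a).comp X := by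
      ext p
      simp
    rw [this]
    exact Submodule.sum_mem _ fun a _ => Submodule.smul_mem _ _ (hX l a)
  | zero => simp
  | add x y _ _ hx hy => rw [ContinuousLinearMap.add_comp]; exact add_mem hx hy
  | smul c x _ hx => rw [ContinuousLinearMap.smul_comp]; exact Submodule.smul_mem _ _ hx

/-- All products of `J` and `n` functionals from `S` are killed. -/
def MomentKilled (f : SchwartzMap E ℂ →L[ℂ] ℂ) (W : Set (E → ℂ)) (S : Submodule ℂ (E →L[ℝ] ℂ))
    (J : E → ℂ) (n : ℕ) : Prop :=
  ∀ (ι : Type) [DecidableEq ι] (s : Finset ι), s.card = n → ∀ ℓ : ι → E →L[ℝ] ℂ,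
    (∀ i ∈ s, ℓ i ∈ S) → (fun p => J p * ∏ i ∈ s, ℓ i p) ∈ killed f W

lemma MomentKilled.mul_slot {f : SchwartzMap E ℂ →L[ℂ] ℂ} {W : Set (E → ℂ)}
    {S : Submodule ℂ (E →L[ℝ] ℂ)} {J : E → ℂ} {ι : Type} [DecidableEq ι] {s : Finset ι}
    (h : MomentKilled f W S J (s.card + 1)) {ℓ₀ : E →L[ℝ] ℂ} (hℓ₀ : ℓ₀ ∈ S)
    {ℓ : ι → E →L[ℝ] ℂ} (hℓ : ∀ i ∈ s, ℓ i ∈ S) :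
    (fun p => J p * ℓ₀ p * ∏ i ∈ s, ℓ i p) ∈ killed f W := by
  have := h (Option ι) (Finset.insertNone s) (by simp) (fun o => o.elim ℓ₀ ℓ)
    (by rintro (_ | i) hi; exacts [hℓ₀, hℓ i (by simpa using hi)])
  simpa [Finset.prod_insertNone, mul_assoc] using this

lemma evalTest_mul_eq_of_sub_mem_killed {f : SchwartzMap E ℂ →L[ℂ] ℂ} {W : Set (E → ℂ)}
    {P Q w : E → ℂ} (hP : ContDiff ℝ ∞ P) (hQ : ContDiff ℝ ∞ Q) (hw : w ∈ W) (hw' : IsTest w)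
    (h : P - Q ∈ killed f W) :
    evalTest f (fun p => P p * w p) = evalTest f (fun p => Q p * w p) := by
  rw [← sub_eq_zero, ← evalTest_sub f (.mul hP hw') (.mul hQ hw')]
  simpa only [Pi.sub_apply, sub_mul] using h.2 w hw hw'

lemma prod_univ_eq_three {ι : Type} [Fintype ι] [DecidableEq ι] (F : ι → ℂ) {i j k : ι}
    (hij : i ≠ j) (hik : i ≠ k) (hjk : j ≠ k) :
    ∏ x, F x = F i * F j * F k * ∏ x ∈ {i, j, k}ᶜ, F x := by
  rw [← Finset.prod_mul_prod_compl {i, j, k} F, Finset.prod_insert (by simp [hij, hik]),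
    Finset.prod_insert (by simpa using hjk), Finset.prod_singleton]
  ring

lemma card_compl_three {ι : Type} [Fintype ι] [DecidableEq ι] {i j k : ι}
    (hij : i ≠ j) (hik : i ≠ k) (hjk : j ≠ k) :
    ({i, j, k}ᶜ : Finset ι).card + 1 < Fintype.card ι := by
  have h := Finset.card_add_card_compl ({i, j, k} : Finset ι)
  rw [Finset.card_insert_of_notMem (by simp [hij, hik]),
    Finset.card_insert_of_notMem (by simpa using hjk), Finset.card_singleton] at h
  omega

end Slots

section Frames

variable {𝕂 : Type} [RCLike 𝕂] {L : Type} {f : SchwartzMap (MatPair 𝕂) ℂ →L[ℂ] ℂ}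
  {coord : L → Fin 3 → MatPair 𝕂 →L[ℝ] ℂ}

lemma contDiff_of_mem_traceFunctions : ∀ Z ∈ traceFunctions 𝕂, ContDiff ℝ ∞ Z :=
  fun _ hZ => hZ.1

lemma momentKilled_of_bracket (hf : ConjInvariant f) {N : Matrix (Fin 2) (Fin 2) 𝕂}
    (hN : N * N = 0) (hS : ∀ l a, (coord l a).comp (bracket N) ∈ slots coord) {J : MatPair 𝕂 → ℂ}
    {c : ℂ} (hJ : ∀ p, J p = c * (fderiv ℝ sqNorm p (bracket N p) : ℝ)) {n : ℕ}
    (h : SlotsKilled f (cutoffs sqNorm (traceFunctions 𝕂)) (slots coord) n) :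
    MomentKilled f (cutoffs sqNorm (traceFunctions 𝕂)) (slots coord) J n := by
  intro ι _ s hs ℓ hℓ
  have := moment_mul_prod_mem_killed contDiff_sqNorm isCompact_sqNorm_le
    contDiff_of_mem_traceFunctions (bracket N) (fun φ hφ => hf.evalTest_bracket hN φ hφ)
    (fun Z hZ p => fderiv_bracket_eq_zero hZ N p) (fun ℓ hℓ => comp_mem_slots hS hℓ)
    (h ι s hs) ℓ hℓ
  convert Submodule.smul_mem _ c this using 1
  ext p
  simp [hJ, mul_assoc]

/-- The reflection orthogonal to `v`, acting on functionals. -/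
def IsReflection (coord : L → Fin 3 → MatPair 𝕂 →L[ℝ] ℂ) (g k : Matrix (Fin 2) (Fin 2) 𝕂)
    (v : Fin 3 → ℝ) (s : ℝ) : Prop :=
  ∀ l a p, coord l a (sandwich g k (pairTranspose p)) =
    coord l a p - 2 * s * v a * ∑ b, v b * coord l b p

lemma trace_reflection {g k : Matrix (Fin 2) (Fin 2) 𝕂} (hgk : g * k = 1)
    (x : Matrix (Fin 2) (Fin 2) 𝕂) : (g * xᵀ * k).trace = x.trace := by
  rw [Matrix.trace_mul_comm, ← mul_assoc, mul_eq_one_comm.1 hgk, one_mul, Matrix.trace_transpose]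

lemma slotForm_eq_zero_of_reflection [Fintype L] (hf : ConjInvariant f) (hf' : TransposeSkew f)
    {bar : L → L} {C : ℂ} {τ : MatPair 𝕂 → ℂ} (hτ : τ ∈ traceFunctions 𝕂)
    (hsq : ∀ p, (sqNorm p : ℂ) = C * ∑ l, ∑ a, coord l a p * coord (bar l) a p + τ p)
    {g k : Matrix (Fin 2) (Fin 2) 𝕂} (hgk : g * k = 1) {v : Fin 3 → ℝ} {s : ℝ}
    (hs : s * ∑ a, v a ^ 2 = 1) (hr : IsReflection coord g k v s)
    {w : MatPair 𝕂 → ℂ} (hw : w ∈ cutoffs sqNorm (traceFunctions 𝕂)) (hw' : IsTest w)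
    {ι : Type} [Fintype ι] (c : ι → L) (u : ι → Fin 3 → ℝ) (hu : ∀ i, ∑ a, u i a * v a = 0) :
    slotForm f hw' (linComb coord) c u = 0 := by
  rw [slotForm_apply]
  refine evalTest_reflection hf hf' hgk (.mul (contDiff_prod_clm _ _) hw') fun p => ?_
  congr 1
  · refine Finset.prod_congr rfl fun i _ => ?_
    have h := congrArg (fun r : ℝ => (r : ℂ)) (hu i)
    simp only [Fin.sum_univ_three] at h
    push_cast at h
    simp only [linComb_apply, hr _ _ p, Fin.sum_univ_three]
    linear_combination (-2 * s * (v 0 * coord (c i) 0 p + v 1 * coord (c i) 1 p + v 2 * coord (c i) 2 p)) * h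
  · obtain ⟨h, Z, -, -, hZ, rfl⟩ := hw
    have h1 := trace_reflection hgk p.1
    have h2 := trace_reflection hgk p.2
    have hν : sqNorm (sandwich g k (pairTranspose p)) = sqNorm p := by
      have hs' := congrArg (fun r : ℝ => (r : ℂ)) hs
      simp only [Fin.sum_univ_three] at hs'
      push_cast at hs'
      apply Complex.ofReal_injective
      rw [hsq, hsq, hτ.2 (sandwich g k (pairTranspose p)) p h1 h2]
      congr 2
      refine Finset.sum_congr rfl fun l _ => ?_
      simp only [hr _ _ p, Fin.sum_univ_three]
      linear_combination (4 * s * (v 0 * coord l 0 p + v 1 * coord l 1 p + v 2 * coord l 2 p) *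
        (v 0 * coord (bar l) 0 p + v 1 * coord (bar l) 1 p + v 2 * coord (bar l) 2 p)) * hs'
    simp only [hν, hZ.2 (sandwich g k (pairTranspose p)) p h1 h2]

end Frames

section RealCase

/-- The coordinates of the traceless parts of a pair of real matrices. -/
noncomputable def realFrame (l : Bool) : Fin 3 → MatPair ℝ →L[ℝ] ℂ :=
  fun a => Complex.ofRealCLM.comp ((1 / 2 : ℝ) • ![entry l 0 1 - entry l 1 0,
    entry l 0 0 - entry l 1 1, entry l 0 1 + entry l 1 0] a)

lemma realFrame_zero (l : Bool) (p : MatPair ℝ) :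
    realFrame l 0 p = (entry l 0 1 p - entry l 1 0 p) / 2 := by
  simp [realFrame]; ring

lemma realFrame_one (l : Bool) (p : MatPair ℝ) :
    realFrame l 1 p = (entry l 0 0 p - entry l 1 1 p) / 2 := by
  simp [realFrame]; ring

lemma realFrame_two (l : Bool) (p : MatPair ℝ) :
    realFrame l 2 p = (entry l 0 1 p + entry l 1 0 p) / 2 := by
  simp [realFrame]; ring

lemma entry_bracket {𝕂 : Type} [RCLike 𝕂] (N : Matrix (Fin 2) (Fin 2) 𝕂) (l : Bool) (i j : Fin 2)
    (p : MatPair 𝕂) : entry l i j (bracket N p) =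
      N i 0 * entry l 0 j p + N i 1 * entry l 1 j p -
        (entry l i 0 p * N 0 j + entry l i 1 p * N 1 j) := by
  cases l <;> simp [Matrix.mul_apply, Fin.sum_univ_two]

lemma entry_sandwich_transpose {𝕂 : Type} [RCLike 𝕂] (g k : Matrix (Fin 2) (Fin 2) 𝕂) (l : Bool)
    (i j : Fin 2) (p : MatPair 𝕂) : entry l i j (sandwich g k (pairTranspose p)) =
      (g i 0 * entry l 0 0 p + g i 1 * entry l 0 1 p) * k 0 j +
        (g i 0 * entry l 1 0 p + g i 1 * entry l 1 1 p) * k 1 j := by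
  cases l <;> simp [Matrix.mul_apply, Fin.sum_univ_two]

lemma fderiv_sqNorm_real (p v : MatPair ℝ) : fderiv ℝ sqNorm p v =
    ∑ l, ∑ i, ∑ j, 2 * entry l i j p * entry l i j v := by
  rw [fderiv_sqNorm]
  simp [Fintype.sum_prod_type, realCoord]

lemma comp_mem_slots_of_eq {𝕂 : Type} [RCLike 𝕂] {L : Type} {coord : L → Fin 3 → MatPair 𝕂 →L[ℝ] ℂ}
    {X : MatPair 𝕂 →L[ℝ] MatPair 𝕂} (M : L → Fin 3 → Fin 3 → ℂ)
    (h : ∀ l a p, coord l a (X p) = ∑ b, M l a b * coord l b p) (l : L) (a : Fin 3) :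
    (coord l a).comp X ∈ slots coord := by
  have : (coord l a).comp X = ∑ b, M l a b • coord l b := by
    ext p
    simp [h]
  rw [this]
  exact Submodule.sum_mem _ fun b _ => Submodule.smul_mem _ _ (coord_mem_slots coord l b)

variable {f : SchwartzMap (MatPair ℝ) ℂ →L[ℂ] ℂ}

lemma momentKilled_real_one (hf : ConjInvariant f) {n : ℕ}
    (h : SlotsKilled f (cutoffs sqNorm (traceFunctions ℝ)) (slots realFrame) n) :
    MomentKilled f (cutoffs sqNorm (traceFunctions ℝ)) (slots realFrame)
      (fun p => ∑ l, realFrame l 0 p * realFrame l 1 p) n := by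
  refine momentKilled_of_bracket (N := !![0, 1; 0, 0]) (c := -1 / 8) hf
    (by ext i j; fin_cases i <;> fin_cases j <;> simp) ?_ ?_ h
  · refine comp_mem_slots_of_eq (fun _ => ![![0, -1, 0], ![-1, 0, 1], ![0, -1, 0]]) fun l a p => ?_
    fin_cases a <;>
      simp [Fin.sum_univ_three, realFrame_zero, realFrame_one, realFrame_two, entry_bracket] <;>
      ring
  · intro p
    simp [fderiv_sqNorm_real, Fin.sum_univ_two, realFrame_zero, realFrame_one, entry_bracket]
    ring

lemma momentKilled_real_two (hf : ConjInvariant f) {n : ℕ}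
    (h : SlotsKilled f (cutoffs sqNorm (traceFunctions ℝ)) (slots realFrame) n) :
    MomentKilled f (cutoffs sqNorm (traceFunctions ℝ)) (slots realFrame)
      (fun p => ∑ l, realFrame l 0 p * realFrame l 2 p) n := by
  refine momentKilled_of_bracket (N := !![1, -1; 1, -1]) (c := 1 / 16) hf
    (by ext i j; fin_cases i <;> fin_cases j <;> simp [Matrix.mul_apply, Fin.sum_univ_two]) ?_ ?_ h
  · refine comp_mem_slots_of_eq (fun _ => ![![0, 0, 2], ![0, 0, -2], ![2, 2, 0]]) fun l a p => ?_
    fin_cases a <;>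
      simp [Fin.sum_univ_three, realFrame_zero, realFrame_one, realFrame_two, entry_bracket] <;>
      ring
  · intro p
    simp [fderiv_sqNorm_real, Fin.sum_univ_two, realFrame_zero, realFrame_two, entry_bracket]
    ring

lemma minor_mem_killed_real (hf : ConjInvariant f) {ι : Type} [DecidableEq ι] {s : Finset ι}
    (h : SlotsKilled f (cutoffs sqNorm (traceFunctions ℝ)) (slots realFrame) (s.card + 1))
    {ℓ : ι → MatPair ℝ →L[ℝ] ℂ} (hℓ : ∀ i ∈ s, ℓ i ∈ slots realFrame) (l m n : Bool) :
    (fun p => realFrame l 0 p * (realFrame m 1 p * realFrame n 2 p -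
      realFrame m 2 p * realFrame n 1 p) * ∏ i ∈ s, ℓ i p) ∈
      killed f (cutoffs sqNorm (traceFunctions ℝ)) := by
  have h1 := (momentKilled_real_one hf h).mul_slot (coord_mem_slots realFrame (!l) 2) hℓ
  have h2 := (momentKilled_real_two hf h).mul_slot (coord_mem_slots realFrame (!l) 1) hℓ
  rcases eq_or_ne m n with rfl | hmn
  · convert Submodule.zero_mem (killed f (cutoffs sqNorm (traceFunctions ℝ))) using 1
    ext p
    simp only [Pi.zero_apply]
    ring
  · have hlmn : ∀ l m n : Bool, m ≠ n → (m = l ∧ n = !l) ∨ (m = !l ∧ n = l) := by decide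
    rcases hlmn l m n hmn with ⟨rfl, rfl⟩ | ⟨rfl, rfl⟩
    · convert sub_mem h1 h2 using 1
      ext p
      cases m <;> simp <;> ring
    · convert sub_mem h2 h1 using 1
      ext p
      cases n <;> simp <;> ring

lemma slotForm_swap_real (hf : ConjInvariant f) {ι : Type} [DecidableEq ι] [Fintype ι]
    (ih : ∀ m < Fintype.card ι,
      SlotsKilled f (cutoffs sqNorm (traceFunctions ℝ)) (slots realFrame) m)
    {w : MatPair ℝ → ℂ} (hw : w ∈ cutoffs sqNorm (traceFunctions ℝ)) (hw' : IsTest w)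
    (c : ι → Bool) (u : ι → Fin 3 → ℝ) {i j k : ι} (hij : i ≠ j) (hik : i ≠ k) (hjk : j ≠ k)
    (hi : u i 0 = 0) (hj : u j 0 = 0) (hk : u k = Pi.single 0 1) :
    slotForm f hw' (linComb realFrame) c (u ∘ Equiv.swap i j) =
      slotForm f hw' (linComb realFrame) c u := by
  rw [slotForm_apply, slotForm_apply]
  refine evalTest_mul_eq_of_sub_mem_killed (contDiff_prod_clm _ _) (contDiff_prod_clm _ _)
    hw hw' ?_
  have h := minor_mem_killed_real hf (ih _ (card_compl_three hij hik hjk))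
    (ℓ := fun x => linComb realFrame (c x) (u x)) (fun x _ => linComb_mem_slots _ _ _)
    (c k) (c i) (c j)
  convert Submodule.smul_mem _ ((u j 1 * u i 2 - u j 2 * u i 1 : ℝ) : ℂ) h using 1
  ext p
  have hrest : ∏ x ∈ {i, j, k}ᶜ, linComb realFrame (c x) ((u ∘ Equiv.swap i j) x) p =
      ∏ x ∈ {i, j, k}ᶜ, linComb realFrame (c x) (u x) p := by
    refine Finset.prod_congr rfl fun x hx => ?_
    simp only [Finset.mem_compl, Finset.mem_insert, Finset.mem_singleton, not_or] at hx
    rw [Function.comp_apply, Equiv.swap_apply_of_ne_of_ne hx.1 hx.2.1]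
  simp only [Pi.sub_apply]
  rw [prod_univ_eq_three _ hij hik hjk, prod_univ_eq_three _ hij hik hjk, hrest]
  simp only [Function.comp_apply, Equiv.swap_apply_left, Equiv.swap_apply_right,
    Equiv.swap_apply_of_ne_of_ne hik.symm hjk.symm, hk, Pi.smul_apply, smul_eq_mul]
  have hk0 : ∀ l, linComb realFrame l (Pi.single 0 1) p = realFrame l 0 p := fun l => by
    simp [Fin.sum_univ_three]
  have hs : ∀ l (v : Fin 3 → ℝ), v 0 = 0 →
      linComb realFrame l v p = v 1 * realFrame l 1 p + v 2 * realFrame l 2 p := fun l v hv => by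
    simp [Fin.sum_univ_three, hv]
  rw [hk0, hs _ _ hi, hs _ _ hi, hs _ _ hj, hs _ _ hj]
  push_cast
  ring

lemma sqNorm_real (p : MatPair ℝ) : (sqNorm p : ℂ) =
    2 * ∑ l, ∑ a, realFrame l a p * realFrame l a p +
      ((p.1.trace ^ 2 + p.2.trace ^ 2) / 2 : ℝ) := by
  simp [sqNorm_eq, Fin.sum_univ_three, Fin.sum_univ_two, realFrame_zero, realFrame_one,
    realFrame_two, Matrix.trace, RCLike.normSq_apply]
  ring

variable {f : SchwartzMap (MatPair ℝ) ℂ →L[ℂ] ℂ}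

lemma mem_traceFunctions_of_traces {𝕂 : Type} [RCLike 𝕂] {F : 𝕂 → 𝕂 → ℂ}
    (hF : ContDiff ℝ ∞ (fun t : 𝕂 × 𝕂 => F t.1 t.2)) :
    (fun p : MatPair 𝕂 => F p.1.trace p.2.trace) ∈ traceFunctions 𝕂 := by
  refine ⟨?_, fun p q h1 h2 => by simp only [h1, h2]⟩
  have h : ∀ l, ContDiff ℝ ∞ (fun p : MatPair 𝕂 => entry l 0 0 p + entry l 1 1 p) := fun l =>
    (entry l 0 0 + entry l 1 1 : MatPair 𝕂 →L[ℝ] 𝕂).contDiff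
  convert hF.comp ((h false).prodMk (h true)) using 1
  ext p
  simp [Matrix.trace, Fin.sum_univ_two]

lemma slotForm_eq_zero_of_reflection_real (hf : ConjInvariant f) (hf' : TransposeSkew f)
    {g k : Matrix (Fin 2) (Fin 2) ℝ} (hgk : g * k = 1) {v : Fin 3 → ℝ} {s : ℝ}
    (hs : s * ∑ a, v a ^ 2 = 1) (hr : IsReflection realFrame g k v s)
    {w : MatPair ℝ → ℂ} (hw : w ∈ cutoffs sqNorm (traceFunctions ℝ)) (hw' : IsTest w)
    {ι : Type} [Fintype ι] (c : ι → Bool) (u : ι → Fin 3 → ℝ)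
    (hu : ∀ i, ∑ a, u i a * v a = 0) :
    slotForm f hw' (linComb realFrame) c u = 0 := by
  refine slotForm_eq_zero_of_reflection (bar := id) hf hf' (mem_traceFunctions_of_traces
    (F := fun s t => (((s ^ 2 + t ^ 2) / 2 : ℝ) : ℂ)) ?_) sqNorm_real hgk hs hr hw hw' c u hu
  have h : ContDiff ℝ ∞ (fun t : ℝ × ℝ => (t.1 ^ 2 + t.2 ^ 2) / 2) := by fun_prop
  exact Complex.ofRealCLM.contDiff.comp h

lemma slotForm_real_eq_zero (hf : ConjInvariant f) (hf' : TransposeSkew f) {ι : Type}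
    [DecidableEq ι] [Fintype ι]
    (ih : ∀ m < Fintype.card ι,
      SlotsKilled f (cutoffs sqNorm (traceFunctions ℝ)) (slots realFrame) m)
    (c : ι → Bool) {w : MatPair ℝ → ℂ} (hw : w ∈ cutoffs sqNorm (traceFunctions ℝ))
    (hw' : IsTest w) : slotForm f hw' (linComb realFrame) c = 0 := by
  refine Module.Basis.ext_multilinear (fun _ => Pi.basisFun ℝ (Fin 3)) fun v => ?_
  simp only [Pi.basisFun_apply, _root_.zero_apply]
  by_cases hv : ∀ i, v i ≠ 0
  · refine slotForm_eq_zero_of_reflection_real (g := 1) (k := 1) (v := ![1, 0, 0]) (s := 1)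
      hf hf' (one_mul 1) (by simp [Fin.sum_univ_three]) ?_ hw hw' c _ fun i => ?_
    · intro l a p
      fin_cases a <;> simp [Fin.sum_univ_three, realFrame_zero, realFrame_one, realFrame_two,
        entry_sandwich_transpose] <;> ring
    · simp [Fin.sum_univ_three, Pi.single_eq_of_ne (hv i).symm]
  push Not at hv
  obtain ⟨k, hk⟩ := hv
  set T := slotForm f hw' (linComb realFrame) c with hT
  have hrefl : ∀ β : Fin 3 → ℝ, β 0 = 0 → β ≠ 0 →
      T (fun i => if i ∈ Finset.univ.filter (fun i => v i ≠ 0) then β else Pi.single 0 1) = 0 := by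
    intro β hβ0 hβ
    have hpos : β 1 ^ 2 + β 2 ^ 2 ≠ 0 := by
      intro h
      refine hβ (funext fun a => ?_)
      have h1 : β 1 = 0 := by nlinarith [sq_nonneg (β 1), sq_nonneg (β 2)]
      have h2 : β 2 = 0 := by nlinarith [sq_nonneg (β 1), sq_nonneg (β 2)]
      fin_cases a <;> simp [hβ0, h1, h2]
    refine slotForm_eq_zero_of_reflection_real (g := !![β 1, β 2; β 2, -β 1])
      (k := (β 1 ^ 2 + β 2 ^ 2)⁻¹ • !![β 1, β 2; β 2, -β 1]) (v := ![0, -β 2, β 1])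
      (s := (β 1 ^ 2 + β 2 ^ 2)⁻¹) hf hf' ?_ ?_ ?_ hw hw' c _ fun i => ?_
    · ext i j
      fin_cases i <;> fin_cases j <;> simp [Matrix.mul_apply, Fin.sum_univ_two] <;>
        field_simp <;> ring
    · simp [Fin.sum_univ_three]
      field_simp
      ring
    · have hpos' : (β 1 : ℂ) ^ 2 + (β 2 : ℂ) ^ 2 ≠ 0 := by exact_mod_cast hpos
      intro l a p
      fin_cases a <;> simp [Fin.sum_univ_three, realFrame_zero, realFrame_one, realFrame_two,
        entry_sandwich_transpose] <;> field_simp <;> ring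
    · split_ifs
      · simp [Fin.sum_univ_three]
        ring
      · simp [Fin.sum_univ_three]
  refine T.eq_zero_of_symmetric (Finset.univ.filter fun i => v i ≠ 0)
    (LinearMap.ker (LinearMap.proj 0)) (fun _ => Pi.single 0 1) ?_ ?_ _ ?_ ?_
  · intro β hβ
    by_cases h0 : β = 0
    · by_cases hP : ∃ i, v i ≠ 0
      · obtain ⟨i, hi⟩ := hP
        exact T.map_coord_zero i (by simp [hi, h0])
      · push Not at hP
        simpa [hP] using hrefl (Pi.single 1 1) (by simp) (by simp)
    · exact hrefl β (by simpa using hβ) h0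
  · intro u hu hue i hi j hj
    rcases eq_or_ne i j with rfl | hij
    · simp
    have hk' : k ∉ Finset.univ.filter (fun i => v i ≠ 0) := by simp [hk]
    exact slotForm_swap_real hf ih hw hw' c u hij (by rintro rfl; exact hk' hi)
      (by rintro rfl; exact hk' hj) (by simpa using hu i hi) (by simpa using hu j hj) (hue k hk')
  · intro i hi
    simpa [Pi.single_apply, eq_comm] using hi
  · intro i hi
    simp only [Finset.mem_filter, Finset.mem_univ, true_and, not_not] at hi
    rw [hi]

theorem eq_zero_of_conjInvariant_of_transposeSkew_real (hf : ConjInvariant f)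
    (hf' : TransposeSkew f) : f = 0 := by
  refine eq_zero_of_slotsKilled f realCoord one_pos
    (fun p => by simpa [sqNorm] using norm_sq_le_sqNorm p) (traceFunctions ℝ)
    contDiff_of_mem_traceFunctions (slots realFrame) ?_
    (slotsKilled_of_slotForm f _ (linComb realFrame) fun ι _ _ ih c w hw hw' =>
      slotForm_real_eq_zero hf hf' ih c hw hw')
  have htr : ∀ (r : ℝ) (l : Bool), (fun p : MatPair ℝ =>
      ((r * (if l then p.2.trace else p.1.trace) : ℝ) : ℂ)) ∈ traceFunctions ℝ := by
    intro r l
    refine mem_traceFunctions_of_traces (F := fun s t => ((r * (if l then t else s) : ℝ) : ℂ)) ?_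
    have h : ContDiff ℝ ∞ (fun t : ℝ × ℝ => r * (if l then t.2 else t.1)) := by
      cases l <;> simp <;> fun_prop
    exact Complex.ofRealCLM.contDiff.comp h
  rintro ⟨b, l, i, j⟩
  cases b
  · have hmem := coord_mem_slots realFrame l
    refine ⟨![![realFrame l 1, realFrame l 2 + realFrame l 0],
        ![realFrame l 2 - realFrame l 0, - realFrame l 1]] i j, ?_,
      _, htr (![![1 / 2, 0], ![0, 1 / 2]] i j) l, fun p => ?_⟩
    · fin_cases i <;> fin_cases j
      exacts [hmem 1, add_mem (hmem 2) (hmem 0), sub_mem (hmem 2) (hmem 0), neg_mem (hmem 1)]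
    · fin_cases i <;> fin_cases j <;> cases l <;>
        simp [realCoord, realFrame_zero, realFrame_one, realFrame_two, Matrix.trace,
          Fin.sum_univ_two] <;> ring
  · exact ⟨0, zero_mem _, _, htr 0 l, fun p => by simp [realCoord]⟩

end RealCase

section ComplexCase

/-- The coordinates of the traceless parts of a pair of complex matrices in the basis of Pauli
matrices, and their complex conjugates. -/
noncomputable def pauliFrame (l : Bool × Bool) : Fin 3 → MatPair ℂ →L[ℝ] ℂ := fun a =>
  (if l.2 then (Complex.conjCLE : ℂ →L[ℝ] ℂ) else ContinuousLinearMap.id ℝ ℂ).comp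
    (![(1 / 2 : ℂ) • (entry l.1 0 1 + entry l.1 1 0),
      (Complex.I / 2) • (entry l.1 0 1 - entry l.1 1 0),
      (1 / 2 : ℂ) • (entry l.1 0 0 - entry l.1 1 1)] a)

lemma pauliFrame_zero (l : Bool) (p : MatPair ℂ) :
    pauliFrame (l, false) 0 p = (entry l 0 1 p + entry l 1 0 p) / 2 := by
  simp [pauliFrame]; ring

lemma pauliFrame_one (l : Bool) (p : MatPair ℂ) :
    pauliFrame (l, false) 1 p = Complex.I * (entry l 0 1 p - entry l 1 0 p) / 2 := by
  simp [pauliFrame]; ring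

lemma pauliFrame_two (l : Bool) (p : MatPair ℂ) :
    pauliFrame (l, false) 2 p = (entry l 0 0 p - entry l 1 1 p) / 2 := by
  simp [pauliFrame]; ring

lemma pauliFrame_re (l : Bool) (a : Fin 3) (p : MatPair ℂ) : (pauliFrame (l, false) a p).re =
    ![((entry l 0 1 p).re + (entry l 1 0 p).re) / 2, ((entry l 1 0 p).im - (entry l 0 1 p).im) / 2,
      ((entry l 0 0 p).re - (entry l 1 1 p).re) / 2] a := by
  fin_cases a <;> simp [pauliFrame_zero, pauliFrame_one, pauliFrame_two]

lemma pauliFrame_im (l : Bool) (a : Fin 3) (p : MatPair ℂ) : (pauliFrame (l, false) a p).im =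
    ![((entry l 0 1 p).im + (entry l 1 0 p).im) / 2, ((entry l 0 1 p).re - (entry l 1 0 p).re) / 2,
      ((entry l 0 0 p).im - (entry l 1 1 p).im) / 2] a := by
  fin_cases a <;> simp [pauliFrame_zero, pauliFrame_one, pauliFrame_two]

lemma pauliFrame_true (l : Bool) (a : Fin 3) (p : MatPair ℂ) :
    pauliFrame (l, true) a p = (starRingEnd ℂ) (pauliFrame (l, false) a p) := by
  simp [pauliFrame]

lemma fderiv_sqNorm_complex (p v : MatPair ℂ) : fderiv ℝ sqNorm p v =
    ∑ l, ∑ i, ∑ j, 2 * ((entry l i j p).re * (entry l i j v).re +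
      (entry l i j p).im * (entry l i j v).im) := by
  rw [fderiv_sqNorm]
  simp [Fintype.sum_prod_type, realCoord]
  ring

lemma bracket_comp_mem_slots {N : Matrix (Fin 2) (Fin 2) ℂ} (M : Fin 3 → Fin 3 → ℂ)
    (h : ∀ l a p, pauliFrame (l, false) a (bracket N p) =
      ∑ b, M a b * pauliFrame (l, false) b p) (l : Bool × Bool) (a : Fin 3) :
    (pauliFrame l a).comp (bracket N) ∈ slots pauliFrame := by
  refine comp_mem_slots_of_eq
    (fun l a b => if l.2 then (starRingEnd ℂ) (M a b) else M a b) ?_ l a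
  rintro ⟨l, _ | _⟩ a p
  · simpa using h l a p
  · simp [pauliFrame_true, h]

variable {f : SchwartzMap (MatPair ℂ) ℂ →L[ℂ] ℂ}

lemma momentKilled_pauli_of_bracket (hf : ConjInvariant f) {n : ℕ}
    (h : SlotsKilled f (cutoffs sqNorm (traceFunctions ℂ)) (slots pauliFrame) n) (a : Fin 3) :
    MomentKilled f (cutoffs sqNorm (traceFunctions ℂ)) (slots pauliFrame)
      (fun p => ∑ l, (pauliFrame (l, false) (a + 1) p * pauliFrame (l, true) (a + 2) p -
        pauliFrame (l, false) (a + 2) p * pauliFrame (l, true) (a + 1) p)) n := by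
  obtain rfl | rfl | rfl : a = 0 ∨ a = 1 ∨ a = 2 := by fin_cases a <;> simp
  · refine momentKilled_of_bracket (N := !![0, 1; 0, 0]) (c := -Complex.I / 4) hf
      (by ext i j; fin_cases i <;> fin_cases j <;> simp) ?_ ?_ h
    · refine bracket_comp_mem_slots ![![0, 0, -1], ![0, 0, -Complex.I], ![1, Complex.I, 0]]
        fun l a p => ?_
      fin_cases a <;> apply Complex.ext <;>
        simp [Fin.sum_univ_three, pauliFrame_re, pauliFrame_im, entry_bracket] <;> ring
    · intro p
      apply Complex.ext <;> simp [fderiv_sqNorm_complex, Fin.sum_univ_two, pauliFrame_re,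
        pauliFrame_im, pauliFrame_true, entry_bracket] <;> ring
  · refine momentKilled_of_bracket (N := !![0, Complex.I; 0, 0]) (c := Complex.I / 4) hf
      (by ext i j; fin_cases i <;> fin_cases j <;> simp) ?_ ?_ h
    · refine bracket_comp_mem_slots ![![0, 0, -Complex.I], ![0, 0, 1], ![Complex.I, -1, 0]]
        fun l a p => ?_
      fin_cases a <;> apply Complex.ext <;>
        simp [Fin.sum_univ_three, pauliFrame_re, pauliFrame_im, entry_bracket] <;> ring
    · intro p
      apply Complex.ext <;> simp [fderiv_sqNorm_complex, Fin.sum_univ_two, pauliFrame_re,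
        pauliFrame_im, pauliFrame_true, entry_bracket] <;> ring
  · refine momentKilled_of_bracket (N := !![1, -1; 1, -1]) (c := -Complex.I / 8) hf
      (by ext i j; fin_cases i <;> fin_cases j <;> simp [Matrix.mul_apply, Fin.sum_univ_two])
      ?_ ?_ h
    · refine bracket_comp_mem_slots ![![0, -2 * Complex.I, 2], ![2 * Complex.I, 0, 0], ![-2, 0, 0]]
        fun l a p => ?_
      fin_cases a <;> apply Complex.ext <;>
        simp [Fin.sum_univ_three, pauliFrame_re, pauliFrame_im, entry_bracket] <;> ring
    · intro p
      apply Complex.ext <;> simp [fderiv_sqNorm_complex, Fin.sum_univ_two, pauliFrame_re,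
        pauliFrame_im, pauliFrame_true, entry_bracket] <;> ring

lemma sqNorm_complex (p : MatPair ℂ) : (sqNorm p : ℂ) =
    1 * ∑ l, ∑ a, pauliFrame l a p * pauliFrame (l.1, !l.2) a p +
      ((Complex.normSq p.1.trace + Complex.normSq p.2.trace) / 2 : ℝ) := by
  apply Complex.ext <;> simp [sqNorm_eq, Fin.sum_univ_three, Fin.sum_univ_two,
    Fintype.sum_prod_type, pauliFrame_re, pauliFrame_im, pauliFrame_true, Matrix.trace,
    RCLike.normSq_apply, Complex.normSq_apply] <;> ring

lemma isReflection_pauliFrame {v : Fin 3 → ℝ} {s : ℝ} (hs : s * ∑ a, v a ^ 2 = 1) :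
    IsReflection pauliFrame
      !![v 0 - Complex.I * v 1, -v 2; -v 2, -v 0 - Complex.I * v 1]
      ((s : ℂ) • !![v 0 + Complex.I * v 1, -v 2; -v 2, -v 0 + Complex.I * v 1]) v s := by
  have h : ∀ l a p, pauliFrame (l, false) a (sandwich
      !![v 0 - Complex.I * v 1, -v 2; -v 2, -v 0 - Complex.I * v 1]
      ((s : ℂ) • !![v 0 + Complex.I * v 1, -v 2; -v 2, -v 0 + Complex.I * v 1])
      (pairTranspose p)) = pauliFrame (l, false) a p -
        2 * s * v a * ∑ b, v b * pauliFrame (l, false) b p := by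
    intro l a p
    have hs' := congrArg (fun r : ℝ => (r : ℂ)) hs
    simp only [Fin.sum_univ_three] at hs'
    push_cast at hs'
    have hp : ∀ a, pauliFrame (l, false) a p =
        s * (v 0 ^ 2 + v 1 ^ 2 + v 2 ^ 2) * pauliFrame (l, false) a p := fun a => by
      rw [hs', one_mul]
    rw [hp a]
    fin_cases a <;>
      simp [Fin.sum_univ_three, pauliFrame_zero, pauliFrame_one, pauliFrame_two,
        entry_sandwich_transpose] <;> ring_nf <;> simp [Complex.I_sq, pow_three] <;> ring
  rintro ⟨l, _ | _⟩ a p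
  · exact h l a p
  · rw [pauliFrame_true, h]
    simp only [pauliFrame_true, map_sub, map_mul, map_sum, Complex.conj_ofReal, Complex.conj_ofNat]

/-- The triple product of three vectors. -/
def tripleProduct (x y z : Fin 3 → ℂ) : ℂ :=
  x 0 * (y 1 * z 2 - y 2 * z 1) + x 1 * (y 2 * z 0 - y 0 * z 2) + x 2 * (y 0 * z 1 - y 1 * z 0)

lemma tripleProduct_eq_moment (l m n : Bool × Bool) : ∃ (q : Bool × Bool) (ε : ℂ),
    ∀ Z : Bool × Bool → Fin 3 → ℂ, tripleProduct (Z l) (Z m) (Z n) =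
      ε * ∑ a : Fin 3, (∑ b, (Z (b, false) (a + 1) * Z (b, true) (a + 2) -
        Z (b, false) (a + 2) * Z (b, true) (a + 1))) * Z q a := by
  have h3 : (2 : Fin 3) + 2 = 1 := rfl
  have h4 : (1 : Fin 3) + 1 = 2 := rfl
  have h5 : (1 : Fin 3) + 2 = 0 := rfl
  have h6 : (2 : Fin 3) + 1 = 0 := rfl
  simp only [tripleProduct, Fin.sum_univ_three, Fintype.sum_bool, h3, h4, h5, h6, zero_add]
  by_cases h : l = m ∨ l = n ∨ m = n
  · refine ⟨l, 0, fun Z => ?_⟩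
    rcases h with rfl | rfl | rfl <;> ring
  simp only [not_or] at h
  by_cases hmn : m.1 = n.1
  · refine ⟨l, if m.2 then -1 else 1, fun Z => ?_⟩
    rcases l with ⟨_ | _, _ | _⟩ <;> rcases m with ⟨_ | _, _ | _⟩ <;>
      rcases n with ⟨_ | _, _ | _⟩ <;> simp at h hmn <;> simp <;> ring
  by_cases hln : l.1 = n.1
  · refine ⟨m, if l.2 then 1 else -1, fun Z => ?_⟩
    rcases l with ⟨_ | _, _ | _⟩ <;> rcases m with ⟨_ | _, _ | _⟩ <;>
      rcases n with ⟨_ | _, _ | _⟩ <;> simp at h hmn hln <;> simp <;> ring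
  · refine ⟨n, if l.2 then -1 else 1, fun Z => ?_⟩
    rcases l with ⟨_ | _, _ | _⟩ <;> rcases m with ⟨_ | _, _ | _⟩ <;>
      rcases n with ⟨_ | _, _ | _⟩ <;> simp at h hmn hln <;> simp <;> ring

variable {f : SchwartzMap (MatPair ℂ) ℂ →L[ℂ] ℂ}

lemma tripleProduct_mem_killed (hf : ConjInvariant f) {ι : Type} [DecidableEq ι] {s : Finset ι}
    (h : SlotsKilled f (cutoffs sqNorm (traceFunctions ℂ)) (slots pauliFrame) (s.card + 1))
    {ℓ : ι → MatPair ℂ →L[ℝ] ℂ} (hℓ : ∀ i ∈ s, ℓ i ∈ slots pauliFrame) (l m n : Bool × Bool) :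
    (fun p => tripleProduct (fun a => pauliFrame l a p) (fun a => pauliFrame m a p)
      (fun a => pauliFrame n a p) * ∏ i ∈ s, ℓ i p) ∈
      killed f (cutoffs sqNorm (traceFunctions ℂ)) := by
  obtain ⟨q, ε, hq⟩ := tripleProduct_eq_moment l m n
  have hJ := fun a : Fin 3 =>
    (momentKilled_pauli_of_bracket hf h a).mul_slot (coord_mem_slots pauliFrame q a) hℓ
  convert Submodule.smul_mem _ ε (Submodule.sum_mem _ fun a (_ : a ∈ Finset.univ) => hJ a) using 1
  ext p
  rw [hq fun l a => pauliFrame l a p]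
  simp only [Pi.smul_apply, Finset.sum_apply, smul_eq_mul]
  rw [mul_assoc, Finset.sum_mul]

lemma slotForm_antisymmetrization_complex (hf : ConjInvariant f) {ι : Type} [DecidableEq ι]
    [Fintype ι]
    (ih : ∀ m < Fintype.card ι,
      SlotsKilled f (cutoffs sqNorm (traceFunctions ℂ)) (slots pauliFrame) m)
    {w : MatPair ℂ → ℂ} (hw : w ∈ cutoffs sqNorm (traceFunctions ℂ)) (hw' : IsTest w)
    (c : ι → Bool × Bool) (u : ι → Fin 3 → ℝ) {i j k : ι} (hij : i ≠ j) (hik : i ≠ k)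
    (hjk : j ≠ k) (x y z : Fin 3 → ℝ) (U : (Fin 3 → ℝ) → (Fin 3 → ℝ) → (Fin 3 → ℝ) → ℂ)
    (hU : ∀ a b d, U a b d = slotForm f hw' (linComb pauliFrame) c
      (Function.update (Function.update (Function.update u i a) j b) k d)) :
    U x y z - U y x z + (U y z x - U x z y) + (U z x y - U z y x) = 0 := by
  set P : (Fin 3 → ℝ) → (Fin 3 → ℝ) → (Fin 3 → ℝ) → MatPair ℂ → ℂ := fun a b d p =>
    ∏ t, linComb pauliFrame (c t)
      (Function.update (Function.update (Function.update u i a) j b) k d t) p with hP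
  have hPt : ∀ a b d, IsTest (fun p => P a b d p * w p) := fun a b d =>
    .mul (contDiff_prod_clm _ _) hw'
  have hUP : ∀ a b d, U a b d = evalTest f (fun p => P a b d p * w p) := fun a b d => by
    rw [hU, slotForm_apply]
  have hPe : ∀ a b d p, P a b d p = linComb pauliFrame (c i) a p * linComb pauliFrame (c j) b p *
      linComb pauliFrame (c k) d p * ∏ t ∈ {i, j, k}ᶜ, linComb pauliFrame (c t) (u t) p := by
    intro a b d p
    simp only [hP]
    rw [prod_univ_eq_three _ hij hik hjk]
    congr 1
    · simp only [Function.update_self, Function.update_of_ne hij, Function.update_of_ne hik,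
        Function.update_of_ne hjk]
    · refine Finset.prod_congr rfl fun t ht => ?_
      simp only [Finset.mem_compl, Finset.mem_insert, Finset.mem_singleton, not_or] at ht
      rw [Function.update_of_ne ht.2.2, Function.update_of_ne ht.2.1, Function.update_of_ne ht.1]
  simp only [hUP]
  rw [← evalTest_sub f (hPt x y z) (hPt y x z), ← evalTest_sub f (hPt y z x) (hPt x z y),
    ← evalTest_sub f (hPt z x y) (hPt z y x),
    ← evalTest_add f ((hPt x y z).sub (hPt y x z)) ((hPt y z x).sub (hPt x z y)),
    ← evalTest_add f (((hPt x y z).sub (hPt y x z)).add ((hPt y z x).sub (hPt x z y)))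
      ((hPt z x y).sub (hPt z y x))]
  have h := Submodule.smul_mem _
    (tripleProduct (fun a => (x a : ℂ)) (fun a => (y a : ℂ)) (fun a => (z a : ℂ)))
    (tripleProduct_mem_killed hf (ih _ (card_compl_three hij hik hjk))
      (ℓ := fun t => linComb pauliFrame (c t) (u t)) (fun t _ => linComb_mem_slots _ _ _)
      (c i) (c j) (c k))
  rw [← h.2 w hw hw']
  congr 1
  ext p
  simp only [hPe, Pi.smul_apply, smul_eq_mul, tripleProduct, linComb_apply, Fin.sum_univ_three]
  ring

lemma exists_orthogonal (x y : Fin 3 → ℝ) : ∃ (v : Fin 3 → ℝ) (s : ℝ), s * ∑ a, v a ^ 2 = 1 ∧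
    ∑ a, x a * v a = 0 ∧ ∑ a, y a * v a = 0 := by
  have hdet : (!![x 0, x 1, x 2; y 0, y 1, y 2; 0, 0, 0] : Matrix (Fin 3) (Fin 3) ℝ).det = 0 := by
    simp [Matrix.det_fin_three]
  obtain ⟨v, hv, h⟩ := Matrix.exists_mulVec_eq_zero_iff.2 hdet
  refine ⟨v, (∑ a, v a ^ 2)⁻¹, inv_mul_cancel₀ fun h0 => hv (funext fun a => ?_), ?_, ?_⟩
  · have := (Finset.sum_eq_zero_iff_of_nonneg fun a _ => sq_nonneg (v a)).1 h0 a (by simp)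
    simpa using this
  · have := congrFun h 0
    simpa [Matrix.mulVec, dotProduct, Fin.sum_univ_three] using this
  · have := congrFun h 1
    simpa [Matrix.mulVec, dotProduct, Fin.sum_univ_three] using this

lemma slotForm_pair_complex (hf : ConjInvariant f) (hf' : TransposeSkew f)
    {w : MatPair ℂ → ℂ} (hw : w ∈ cutoffs sqNorm (traceFunctions ℂ)) (hw' : IsTest w)
    {ι : Type} [Fintype ι] (c : ι → Bool × Bool) (χ : ι → Bool) (x y : Fin 3 → ℝ) :
    slotForm f hw' (linComb pauliFrame) c (fun i => if χ i then x else y) = 0 := by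
  obtain ⟨v, s, hs, hx, hy⟩ := exists_orthogonal x y
  refine slotForm_eq_zero_of_reflection (bar := fun l => (l.1, !l.2)) hf hf'
    (mem_traceFunctions_of_traces
      (F := fun s t => ((Complex.normSq s + Complex.normSq t) / 2 : ℝ)) ?_) sqNorm_complex ?_ hs
    (isReflection_pauliFrame hs) hw hw' c _ fun i => ?_
  · have h : ContDiff ℝ ∞ (fun t : ℂ × ℂ => (Complex.normSq t.1 + Complex.normSq t.2) / 2) := by
      have hre : ∀ g : ℂ × ℂ → ℂ, ContDiff ℝ ∞ g → ContDiff ℝ ∞ (fun t => Complex.normSq (g t)) := by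
        intro g hg
        simp only [Complex.normSq_eq_norm_sq]
        exact hg.norm_sq ℝ
      exact ((hre _ contDiff_fst).add (hre _ contDiff_snd)).div_const 2
    exact Complex.ofRealCLM.contDiff.comp h
  · have hs' := congrArg (fun r : ℝ => (r : ℂ)) hs
    simp only [Fin.sum_univ_three] at hs'
    push_cast at hs'
    ext i j
    fin_cases i <;> fin_cases j <;> simp [Matrix.mul_apply, Fin.sum_univ_two]
    · linear_combination hs' - s * v 1 ^ 2 * Complex.I_sq
    · ring
    · ring
    · linear_combination hs' - s * v 1 ^ 2 * Complex.I_sq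
  · split_ifs
    exacts [hx, hy]

theorem eq_zero_of_conjInvariant_of_transposeSkew_complex (hf : ConjInvariant f)
    (hf' : TransposeSkew f) : f = 0 := by
  refine eq_zero_of_slotsKilled f realCoord one_pos
    (fun p => by simpa [sqNorm] using norm_sq_le_sqNorm p) (traceFunctions ℂ)
    contDiff_of_mem_traceFunctions (slots pauliFrame) ?_
    (slotsKilled_of_slotForm f _ (linComb pauliFrame) fun ι _ _ ih c w hw hw' =>
      MultilinearMap.eq_zero_of_antisymmetrization _
        (fun χ x y => slotForm_pair_complex hf hf' hw hw' c χ x y)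
        fun u i j k hij hik hjk x y z U hU =>
          slotForm_antisymmetrization_complex hf ih hw hw' c u hij hik hjk x y z U hU)
  have htr : ∀ (r : ℂ →L[ℝ] ℂ) (l : Bool), (fun p : MatPair ℂ =>
      r (if l then p.2.trace else p.1.trace)) ∈ traceFunctions ℂ := by
    intro r l
    refine mem_traceFunctions_of_traces (F := fun s t => r (if l then t else s)) ?_
    refine r.contDiff.comp ?_
    cases l
    exacts [contDiff_fst, contDiff_snd]
  have hmem := fun l => coord_mem_slots pauliFrame l
  rintro ⟨b, l, i, j⟩
  set E : Bool → MatPair ℂ →L[ℝ] ℂ := fun c =>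
    ![![pauliFrame (l, c) 2, pauliFrame (l, c) 0 + (if c then Complex.I else -Complex.I) • pauliFrame (l, c) 1],
      ![pauliFrame (l, c) 0 - (if c then Complex.I else -Complex.I) • pauliFrame (l, c) 1, - pauliFrame (l, c) 2]] i j with hE
  have hEm : ∀ c, E c ∈ slots pauliFrame := by
    intro c
    fin_cases i <;> fin_cases j
    exacts [hmem _ 2, add_mem (hmem _ 0) (Submodule.smul_mem _ _ (hmem _ 1)),
      sub_mem (hmem _ 0) (Submodule.smul_mem _ _ (hmem _ 1)), neg_mem (hmem _ 2)]
  set d : ℝ := ![![1 / 2, 0], ![0, 1 / 2]] i j with hd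
  have hEt : ∀ p, E true p = (starRingEnd ℂ) (E false p) := by
    intro p
    fin_cases i <;> fin_cases j <;> simp [hE, pauliFrame_true, sub_eq_add_neg]
  have hEe : ∀ p, E false p = entry l i j p - d * (if l then p.2.trace else p.1.trace) := by
    intro p
    have ht : (if l then p.2.trace else p.1.trace) = entry l 0 0 p + entry l 1 1 p := by
      cases l <;> simp [Matrix.trace, Fin.sum_univ_two]
    rw [ht]
    fin_cases i <;> fin_cases j <;>
      simp [hE, hd, pauliFrame_zero, pauliFrame_one, pauliFrame_two] <;> ring_nf <;>
      simp [Complex.I_sq] <;> ring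
  cases b
  · refine ⟨(1 / 2 : ℂ) • (E false + E true),
      Submodule.smul_mem _ _ (add_mem (hEm false) (hEm true)),
      _, htr (d • Complex.ofRealCLM.comp Complex.reCLM) l, fun p => ?_⟩
    simp only [_root_.smul_apply, _root_.add_apply, hEt, hEe]
    apply Complex.ext <;> cases l <;> simp [realCoord] <;> ring
  · refine ⟨(-Complex.I / 2) • (E false - E true),
      Submodule.smul_mem _ _ (sub_mem (hEm false) (hEm true)),
      _, htr (d • Complex.ofRealCLM.comp Complex.imCLM) l, fun p => ?_⟩
    simp only [_root_.smul_apply, _root_.sub_apply, hEt, hEe]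
    apply Complex.ext <;> cases l <;> simp [realCoord] <;> ring

end ComplexCase

section Transfer

/-- The action of an isomorphism of fields on pairs of matrices. -/
noncomputable def pairEquiv {𝕂 : Type*} [RCLike 𝕂] {𝕃 : Type} [RCLike 𝕃] (A : 𝕂 ≃ₐ[ℝ] 𝕃) :
    (Matrix (Fin 2) (Fin 2) 𝕂 × Matrix (Fin 2) (Fin 2) 𝕂) ≃L[ℝ] MatPair 𝕃 :=
  have : FiniteDimensional ℝ (Matrix (Fin 2) (Fin 2) 𝕂) :=
    inferInstanceAs (FiniteDimensional ℝ (Fin 2 → Fin 2 → 𝕂))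
  ((A.mapMatrix (m := Fin 2)).toLinearEquiv.prodCongr
    (A.mapMatrix (m := Fin 2)).toLinearEquiv).toContinuousLinearEquiv

lemma pairEquiv_apply {𝕂 : Type*} [RCLike 𝕂] {𝕃 : Type} [RCLike 𝕃] (A : 𝕂 ≃ₐ[ℝ] 𝕃)
    (p : Matrix (Fin 2) (Fin 2) 𝕂 × Matrix (Fin 2) (Fin 2) 𝕂) :
    pairEquiv A p = (A.mapMatrix p.1, A.mapMatrix p.2) := rfl

lemma eq_zero_of_algEquiv {𝕂 : Type*} [RCLike 𝕂] {𝕃 : Type} [RCLike 𝕃] (A : 𝕂 ≃ₐ[ℝ] 𝕃)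
    (h : ∀ f : SchwartzMap (MatPair 𝕃) ℂ →L[ℂ] ℂ, ConjInvariant f → TransposeSkew f → f = 0)
    (f : SchwartzMap (Matrix (Fin 2) (Fin 2) 𝕂 × Matrix (Fin 2) (Fin 2) 𝕂) ℂ →L[ℂ] ℂ)
    (hinv : ∀ g : Matrix (Fin 2) (Fin 2) 𝕂, IsUnit g.det →
      ∀ φ φ' : SchwartzMap (Matrix (Fin 2) (Fin 2) 𝕂 × Matrix (Fin 2) (Fin 2) 𝕂) ℂ,
      (∀ p, φ' p = φ (g * p.1 * g⁻¹, g * p.2 * g⁻¹)) → f φ' = f φ)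
    (hskew : ∀ φ φ' : SchwartzMap (Matrix (Fin 2) (Fin 2) 𝕂 × Matrix (Fin 2) (Fin 2) 𝕂) ℂ,
      (∀ p, φ' p = φ (p.1ᵀ, p.2ᵀ)) → f φ' = - f φ) :
    f = 0 := by
  have hzero := h (f.comp (SchwartzMap.compCLMOfContinuousLinearEquiv ℂ (pairEquiv A))) ?_ ?_
  · ext φ
    have := congrArg (fun T => T (SchwartzMap.compCLMOfContinuousLinearEquiv ℂ
      (pairEquiv A).symm φ)) hzero
    refine Eq.trans ?_ this
    refine congrArg f (SchwartzMap.ext fun p => ?_)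
    exact congrArg φ ((pairEquiv A).symm_apply_apply p).symm
  · intro g hg φ φ' hφ
    set k : Matrix (Fin 2) (Fin 2) 𝕂 := A.symm.mapMatrix g with hk
    have hAk : A.mapMatrix k = g := by
      ext i j
      simp [hk]
    have hgu : IsUnit g := (Matrix.isUnit_iff_isUnit_det g).2 hg
    have hku : IsUnit k := hgu.map A.symm.mapMatrix
    have hkd := (Matrix.isUnit_iff_isUnit_det k).1 hku
    have hinvk : A.mapMatrix k⁻¹ = g⁻¹ := by
      refine (Matrix.inv_eq_right_inv ?_).symm
      rw [← hAk, ← map_mul, Matrix.mul_nonsing_inv k hkd, map_one]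
    refine hinv k hkd _ _ fun p => ?_
    change φ' (pairEquiv A p) = φ (pairEquiv A (k * p.1 * k⁻¹, k * p.2 * k⁻¹))
    rw [hφ]
    congr 1
    simp only [pairEquiv_apply, map_mul, hinvk, hAk]
    rfl
  · intro φ φ' hφ
    refine hskew _ _ fun p => ?_
    change φ' (pairEquiv A p) = φ (pairEquiv A (p.1ᵀ, p.2ᵀ))
    rw [hφ]
    rfl

end Transfer

end Auxiliary

/-- Let `f` be a tempered distribution on `gl₂(𝕂) × gl₂(𝕂)` which is invariant under
simultaneous conjugation `(x,y) ↦ (g·x·g⁻¹, g·y·g⁻¹)` by every `g ∈ GL₂(𝕂)`, and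
anti-invariant under simultaneous transpose `(x,y) ↦ (x^τ, y^τ)`.  Then `f = 0`. -/
theorem gl2_pair_distribution_vanishing {𝕂 : Type*} [RCLike 𝕂]
    (f : SchwartzMap (Matrix (Fin 2) (Fin 2) 𝕂 × Matrix (Fin 2) (Fin 2) 𝕂) ℂ →L[ℂ] ℂ)
    (hinv : ∀ g : Matrix (Fin 2) (Fin 2) 𝕂, IsUnit g.det →
      ∀ φ φ' : SchwartzMap (Matrix (Fin 2) (Fin 2) 𝕂 × Matrix (Fin 2) (Fin 2) 𝕂) ℂ,
      (∀ p, φ' p = φ (g * p.1 * g⁻¹, g * p.2 * g⁻¹)) → f φ' = f φ)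
    (hskew : ∀ φ φ' : SchwartzMap (Matrix (Fin 2) (Fin 2) 𝕂 × Matrix (Fin 2) (Fin 2) 𝕂) ℂ,
      (∀ p, φ' p = φ (p.1ᵀ, p.2ᵀ)) → f φ' = - f φ) :
    f = 0 := by
  rcases RCLike.I_eq_zero_or_im_I_eq_one (K := 𝕂) with h | h
  · exact eq_zero_of_algEquiv
      { RCLike.realRingEquiv h with commutes' := fun r => by simp [RCLike.realRingEquiv] }
      (fun _ => eq_zero_of_conjInvariant_of_transposeSkew_real) f hinv hskew
  · exact eq_zero_of_algEquiv
      { RCLike.complexRingEquiv h with commutes' := fun r => by simp [RCLike.complexRingEquiv] }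
      (fun _ => eq_zero_of_conjInvariant_of_transposeSkew_complex) f hinv hskew
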